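/- arXiv:1906.11908 — 2 statements merged into one kernel-verified Lean document; each statement's English description precedes it below -/
import Mathlib

section
/- There exist 52 distinct points in ℝ² and a set E of 104 unordered pairs of these points such that every point is an endpoint of exactly 4 pairs in E, the closed segments of any two distinct pairs intersect at most in a common endpoint, exactly 101 of the pairs join points at distance exactly 1, and each of the remaining 3 pairs joins points at a distance d with |d − 1| < 0.1. -/
namespace NM
theorem mulB {a b d e x y lo hi : ℝ} (hx : a ≤ x ∧ x ≤ b) (hy : d ≤ y ∧ y ≤ e)
    (h : (lo ≤ a * d ∧ lo ≤ a * e ∧ lo ≤ b * d ∧ lo ≤ b * e) ∧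
      (a * d ≤ hi ∧ a * e ≤ hi ∧ b * d ≤ hi ∧ b * e ≤ hi)) :
    lo ≤ x * y ∧ x * y ≤ hi := by
  obtain ⟨hx1, hx2⟩ := hx
  obtain ⟨hy1, hy2⟩ := hy
  obtain ⟨⟨l1, l2, l3, l4⟩, u1, u2, u3, u4⟩ := h
  rcases le_total 0 y with h0 | h0
  · have A := mul_le_mul_of_nonneg_right hx1 h0
    have B := mul_le_mul_of_nonneg_right hx2 h0
    constructor
    · rcases le_total 0 a with ha | ha <;> nlinarith
    · rcases le_total 0 b with ha | ha <;> nlinarith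
  · have A := mul_le_mul_of_nonpos_right hx1 h0
    have B := mul_le_mul_of_nonpos_right hx2 h0
    constructor
    · rcases le_total 0 b with ha | ha <;> nlinarith
    · rcases le_total 0 a with ha | ha <;> nlinarith

theorem invB {a b x lo hi : ℝ} (hx : a ≤ x ∧ x ≤ b)
    (h : 0 < a ∧ lo * b ≤ 1 ∧ 1 ≤ hi * a ∧ 0 ≤ lo ∧ 0 ≤ hi) : lo ≤ x⁻¹ ∧ x⁻¹ ≤ hi := by
  obtain ⟨h1, h2, h3, h4, h5⟩ := h
  have hx0 : 0 < x := lt_of_lt_of_le h1 hx.1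
  rw [inv_eq_one_div]
  constructor
  · rw [le_div_iff₀ hx0]; nlinarith [hx.2]
  · rw [div_le_iff₀ hx0]; nlinarith [hx.1]

theorem sqB {a b x lo hi : ℝ} (hx : a ≤ x ∧ x ≤ b)
    (h : lo ^ 2 ≤ a ∧ b ≤ hi ^ 2 ∧ 0 ≤ hi) : lo ≤ √x ∧ √x ≤ hi :=
  ⟨Real.le_sqrt_of_sq_le (h.1.trans hx.1), Real.sqrt_le_iff.2 ⟨h.2.2, hx.2.trans h.2.1⟩⟩

noncomputable section
def rr (_c : ℝ) : ℝ := √(3)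
def cc (c : ℝ) : ℝ := c * c
def ss (c : ℝ) : ℝ := √(1 + (-1) * cc c)
def rs (c : ℝ) : ℝ := (rr c) * (ss c)
def rc (c : ℝ) : ℝ := (rr c) * c
def s2 (c : ℝ) : ℝ := (ss c) * (ss c)
def rsc (c : ℝ) : ℝ := (rs c) * c
def dd (c : ℝ) : ℝ := 3 + 4 * s2 c + (-4) * rsc c
def di (c : ℝ) : ℝ := (dd c)⁻¹
def k1 (c : ℝ) : ℝ := √(1 * di c + (-1/4))
def ea (c : ℝ) : ℝ := (5/2) * ss c + (-1/2) * rc c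
def eb (c : ℝ) : ℝ := (1/2) * rs c + (-3/2) * c
def ak (c : ℝ) : ℝ := (ea c) * (k1 c)
def bk (c : ℝ) : ℝ := (eb c) * (k1 c)
def xs (c : ℝ) : ℝ := (7/4) * c + (3/4) * rs c + 1 * ak c
def ys (c : ℝ) : ℝ := (5/4) * ss c + (-1/4) * rc c + 1 * bk c
def wx (c : ℝ) : ℝ := 3 * c + (-1) * xs c
def wy (c : ℝ) : ℝ := 3 * ss c + (-1) * ys c
def wx2 (c : ℝ) : ℝ := (wx c) * (wx c)
def wy2 (c : ℝ) : ℝ := (wy c) * (wy c)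
def ee (c : ℝ) : ℝ := 1 * wx2 c + 1 * wy2 c
def ei (c : ℝ) : ℝ := (ee c)⁻¹
def pp (c : ℝ) : ℝ := (1/2) + (-3/2) * ei c
def p2 (c : ℝ) : ℝ := (pp c) * (pp c)
def k2 (c : ℝ) : ℝ := √(1 * ei c + (-1) * p2 c)
def px (c : ℝ) : ℝ := (pp c) * (wx c)
def py (c : ℝ) : ℝ := (pp c) * (wy c)
def kx (c : ℝ) : ℝ := (k2 c) * (wx c)
def ky (c : ℝ) : ℝ := (k2 c) * (wy c)
def xt (c : ℝ) : ℝ := 1 * xs c + 1 * px c + 1 * ky c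
def yt (c : ℝ) : ℝ := 1 * ys c + 1 * py c + (-1) * kx c
def rxt (c : ℝ) : ℝ := (rr c) * (xt c)
def ryt (c : ℝ) : ℝ := (rr c) * (yt c)
def rxs (c : ℝ) : ℝ := (rr c) * (xs c)
def rys (c : ℝ) : ℝ := (rr c) * (ys c)
def xf (c : ℝ) : ℝ := (3/2) * c + (1/2) * xt c + (-1/2) * ryt c + (3/2) * rs c
def yf (c : ℝ) : ℝ := (3/2) * ss c + (1/2) * yt c + (1/2) * rxt c + (-3/2) * rc c
def xv (c : ℝ) : ℝ := (1/2) * xs c + (1/2) * xt c + (1/2) * ryt c + (-1/2) * rys c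
def yv (c : ℝ) : ℝ := (1/2) * ys c + (1/2) * yt c + (-1/2) * rxt c + (1/2) * rxs c
def ff (c : ℝ) : ℝ := 1 * xf c + (-1) * xv c
end

set_option maxHeartbeats 4000000 in
theorem bnd0 (c : ℝ) (hc : (3917817/10000000) ≤ c ∧ c ≤ (3917817/10000000)) :
    ((4653/62500000) ≤ ff c ∧ ff c ≤ (74643/1000000000)) := by
  have h_rr : (1732050807/1000000000) ≤ rr c ∧ rr c ≤ (216506351/125000000) := by
    unfold rr
    refine sqB (a := 3) (b := 3) ⟨?_, ?_⟩ (by norm_num) <;> linarith only []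
  have h_cc : (1534929/10000000) ≤ cc c ∧ cc c ≤ (153492901/1000000000) := mulB hc hc (by norm_num)
  have h_ss : (230014551/250000000) ≤ ss c ∧ ss c ≤ (184011641/200000000) := by
    unfold ss
    refine sqB (a := (846507099/1000000000)) (b := (8465071/10000000)) ⟨?_, ?_⟩ (by norm_num) <;> linarith only [h_cc.1, h_cc.2]
  have h_rs : (796793777/500000000) ≤ rs c ∧ rs c ≤ (796793779/500000000) := mulB h_rr h_ss (by norm_num)
  have h_rc : (678585809/1000000000) ≤ rc c ∧ rc c ≤ (678585811/1000000000) := mulB h_rr hc (by norm_num)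
  have h_s2 : (423253549/500000000) ≤ s2 c ∧ s2 c ≤ (846507101/1000000000) := mulB h_ss h_ss (by norm_num)
  have h_rsc : (624338441/1000000000) ≤ rsc c ∧ rsc c ≤ (624338443/1000000000) := mulB h_rs hc (by norm_num)
  have h_dd : (194433731/50000000) ≤ dd c ∧ dd c ≤ (48608433/12500000) := by
    unfold dd; constructor <;> linarith only [h_s2.1, h_s2.2, h_rsc.1, h_rsc.2]
  have h_di : (8036157/31250000) ≤ di c ∧ di c ≤ (128578513/500000000) := invB h_dd (by norm_num)
  have h_k1 : (21149799/250000000) ≤ k1 c ∧ k1 c ≤ (84599209/1000000000) := by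
    unfold k1
    refine sqB (a := (223657/31250000)) (b := (3578513/500000000)) ⟨?_, ?_⟩ (by norm_num) <;> linarith only [h_di.1, h_di.2]
  have h_ea : (490213151/250000000) ≤ ea c ∧ ea c ≤ (15319161/7812500) := by
    unfold ea; constructor <;> linarith only [h_ss.1, h_ss.2, h_rc.1, h_rc.2]
  have h_eb : (209121227/1000000000) ≤ eb c ∧ eb c ≤ (209121229/1000000000) := by
    unfold eb; constructor <;> linarith only [h_rs.1, h_rs.2, hc.1, hc.2]
  have h_ak : (165886553/1000000000) ≤ ak c ∧ ak c ≤ (8294329/50000000) := mulB h_ea h_k1 (by norm_num)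
  have h_bk : (17691487/1000000000) ≤ bk c ∧ bk c ≤ (17691491/1000000000) := mulB h_eb h_k1 (by norm_num)
  have h_xs : (2046695193/1000000000) ≤ xs c ∧ xs c ≤ (255836903/125000000) := by
    unfold xs; constructor <;> linarith only [hc.1, hc.2, h_rs.1, h_rs.2, h_ak.1, h_ak.2]
  have h_ys : (998117789/1000000000) ≤ ys c ∧ ys c ≤ (199623559/200000000) := by
    unfold ys; constructor <;> linarith only [h_ss.1, h_ss.2, h_rc.1, h_rc.2, h_bk.1, h_bk.2]
  have h_wx : (-217837531/250000000) ≤ wx c ∧ wx c ≤ (-871350093/1000000000) := by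
    unfold wx; constructor <;> linarith only [hc.1, hc.2, h_xs.1, h_xs.2]
  have h_wy : (1762056817/1000000000) ≤ wy c ∧ wy c ≤ (881028413/500000000) := by
    unfold wy; constructor <;> linarith only [h_ss.1, h_ss.2, h_ys.1, h_ys.2]
  have h_wx2 : (94906373/125000000) ≤ wx2 c ∧ wx2 c ≤ (759251039/1000000000) := mulB h_wx h_wx (by norm_num)
  have h_wy2 : (1552422113/500000000) ≤ wy2 c ∧ wy2 c ≤ (3104844259/1000000000) := mulB h_wy h_wy (by norm_num)
  have h_ee : (386409521/100000000) ≤ ee c ∧ ee c ≤ (1932047649/500000000) := by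
    unfold ee; constructor <;> linarith only [h_wx2.1, h_wx2.2, h_wy2.1, h_wy2.2]
  have h_ei : (258792789/1000000000) ≤ ei c ∧ ei c ≤ (64698199/250000000) := invB h_ee (by norm_num)
  have h_pp : (55905403/500000000) ≤ pp c ∧ pp c ≤ (111810817/1000000000) := by
    unfold pp; constructor <;> linarith only [h_ei.1, h_ei.2]
  have h_p2 : (1562707/125000000) ≤ p2 c ∧ p2 c ≤ (12501659/1000000000) := mulB h_pp h_pp (by norm_num)
  have h_k2 : (496277271/1000000000) ≤ k2 c ∧ k2 c ≤ (248138641/500000000) := by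
    unfold k2
    refine sqB (a := (24629113/100000000)) (b := (12314557/50000000)) ⟨?_, ?_⟩ (by norm_num) <;> linarith only [h_ei.1, h_ei.2, h_p2.1, h_p2.2]
  have h_px : (-9742637/100000000) ≤ px c ∧ px c ≤ (-24356589/250000000) := mulB h_pp h_wx (by norm_num)
  have h_py : (6156781/31250000) ≤ py c ∧ py c ≤ (98508507/500000000) := mulB h_pp h_wy (by norm_num)
  have h_kx : (-54053909/125000000) ≤ kx c ∧ kx c ≤ (-216215623/500000000) := mulB h_k2 h_wx (by norm_num)
  have h_ky : (218617187/250000000) ≤ ky c ∧ ky c ≤ (874468773/1000000000) := mulB h_k2 h_wy (by norm_num)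
  have h_xt : (2823737571/1000000000) ≤ xt c ∧ xt c ≤ (2823737641/1000000000) := by
    unfold xt; constructor <;> linarith only [h_xs.1, h_xs.2, h_px.1, h_px.2, h_ky.1, h_ky.2]
  have h_yt : (1627566027/1000000000) ≤ yt c ∧ yt c ≤ (1627566081/1000000000) := by
    unfold yt; constructor <;> linarith only [h_ys.1, h_ys.2, h_py.1, h_py.2, h_kx.1, h_kx.2]
  have h_rxt : (2445428469/500000000) ≤ rxt c ∧ rxt c ≤ (4890857063/1000000000) := mulB h_rr h_xt (by norm_num)
  have h_ryt : (56380541/20000000) ≤ ryt c ∧ ryt c ≤ (1409513573/500000000) := mulB h_rr h_yt (by norm_num)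
  have h_rxs : (177249003/50000000) ≤ rxs c ∧ rxs c ≤ (3544980117/1000000000) := mulB h_rr h_xs (by norm_num)
  have h_rys : (1728790721/1000000000) ≤ rys c ∧ rys c ≤ (864395367/500000000) := mulB h_rr h_ys (by norm_num)
  have h_xf : (2980409093/1000000000) ≤ xf c ∧ xf c ≤ (2980409183/1000000000) := by
    unfold xf; constructor <;> linarith only [hc.1, hc.2, h_xt.1, h_xt.2, h_ryt.1, h_ryt.2, h_rs.1, h_rs.2]
  have h_yf : (452677509/125000000) ≤ yf c ∧ yf c ≤ (1810710083/500000000) := by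
    unfold yf; constructor <;> linarith only [h_ss.1, h_ss.2, h_yt.1, h_yt.2, h_rxt.1, h_rxt.2, h_rc.1, h_rc.2]
  have h_xv : (149016727/50000000) ≤ xv c ∧ xv c ≤ (596066929/200000000) := by
    unfold xv; constructor <;> linarith only [h_xs.1, h_xs.2, h_xt.1, h_xt.2, h_ryt.1, h_ryt.2, h_rys.1, h_rys.2]
  have h_yv : (319951703/500000000) ≤ yv c ∧ yv c ≤ (79987941/125000000) := by
    unfold yv; constructor <;> linarith only [h_ys.1, h_ys.2, h_yt.1, h_yt.2, h_rxt.1, h_rxt.2, h_rxs.1, h_rxs.2]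
  have h_ff : (4653/62500000) ≤ ff c ∧ ff c ≤ (74643/1000000000) := by
    unfold ff; constructor <;> linarith only [h_xf.1, h_xf.2, h_xv.1, h_xv.2]
  exact h_ff

set_option maxHeartbeats 4000000 in
theorem bnd1 (c : ℝ) (hc : (1959009/5000000) ≤ c ∧ c ≤ (1959009/5000000)) :
    ((-74409/1000000000) ≤ ff c ∧ ff c ≤ (-37071/500000000)) := by
  have h_rr : (1732050807/1000000000) ≤ rr c ∧ rr c ≤ (216506351/125000000) := by
    unfold rr
    refine sqB (a := 3) (b := 3) ⟨?_, ?_⟩ (by norm_num) <;> linarith only []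
  have h_cc : (3070173/20000000) ≤ cc c ∧ cc c ≤ (153508651/1000000000) := mulB hc hc (by norm_num)
  have h_ss : (230012411/250000000) ≤ ss c ∧ ss c ≤ (460024823/500000000) := by
    unfold ss
    refine sqB (a := (846491349/1000000000)) (b := (16929827/20000000)) ⟨?_, ?_⟩ (by norm_num) <;> linarith only [h_cc.1, h_cc.2]
  have h_rs : (199196591/125000000) ≤ rs c ∧ rs c ≤ (1593572733/1000000000) := mulB h_rr h_ss (by norm_num)
  have h_rc : (678620623/1000000000) ≤ rc c ∧ rc c ≤ (1085793/1600000) := mulB h_rr hc (by norm_num)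
  have h_s2 : (846491347/1000000000) ≤ s2 c ∧ s2 c ≤ (105811419/125000000) := mulB h_ss h_ss (by norm_num)
  have h_rsc : (624364663/1000000000) ≤ rsc c ∧ rsc c ≤ (312182333/500000000) := mulB h_rs hc (by norm_num)
  have h_dd : (972126681/250000000) ≤ dd c ∧ dd c ≤ (972126689/250000000) := by
    unfold dd; constructor <;> linarith only [h_s2.1, h_s2.2, h_rsc.1, h_rsc.2]
  have h_di : (257168127/1000000000) ≤ di c ∧ di c ≤ (25716813/100000000) := invB h_dd (by norm_num)
  have h_k1 : (84664791/1000000000) ≤ k1 c ∧ k1 c ≤ (8466481/100000000) := by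
    unfold k1
    refine sqB (a := (7168127/1000000000)) (b := (716813/100000000)) ⟨?_, ?_⟩ (by norm_num) <;> linarith only [h_di.1, h_di.2]
  have h_ea : (1960813797/1000000000) ≤ ea c ∧ ea c ≤ (490203451/250000000) := by
    unfold ea; constructor <;> linarith only [h_ss.1, h_ss.2, h_rc.1, h_rc.2]
  have h_eb : (13067729/62500000) ≤ eb c ∧ eb c ≤ (209083667/1000000000) := by
    unfold eb; constructor <;> linarith only [h_rs.1, h_rs.2, hc.1, hc.2]
  have h_ak : (16601189/100000000) ≤ ak c ∧ ak c ≤ (166011929/1000000000) := mulB h_ea h_k1 (by norm_num)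
  have h_bk : (2212753/125000000) ≤ bk c ∧ bk c ≤ (17702029/1000000000) := mulB h_eb h_k1 (by norm_num)
  have h_xs : (1023422293/500000000) ≤ xs c ∧ xs c ≤ (2046844629/1000000000) := by
    unfold xs; constructor <;> linarith only [hc.1, hc.2, h_rs.1, h_rs.2, h_ak.1, h_ak.2]
  have h_ys : (499054461/500000000) ≤ ys c ∧ ys c ≤ (998108931/1000000000) := by
    unfold ys; constructor <;> linarith only [h_ss.1, h_ss.2, h_rc.1, h_rc.2, h_bk.1, h_bk.2]
  have h_wx : (-871439229/1000000000) ≤ wx c ∧ wx c ≤ (-435719593/500000000) := by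
    unfold wx; constructor <;> linarith only [hc.1, hc.2, h_xs.1, h_xs.2]
  have h_wy : (1762040001/1000000000) ≤ wy c ∧ wy c ≤ (110127501/62500000) := by
    unfold wy; constructor <;> linarith only [h_ss.1, h_ss.2, h_ys.1, h_ys.2]
  have h_wx2 : (379703127/500000000) ≤ wx2 c ∧ wx2 c ≤ (75940633/100000000) := mulB h_wx h_wx (by norm_num)
  have h_wy2 : (620956993/200000000) ≤ wy2 c ∧ wy2 c ≤ (1552392509/500000000) := mulB h_wy h_wy (by norm_num)
  have h_ee : (3864191219/1000000000) ≤ ee c ∧ ee c ≤ (966047837/250000000) := by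
    unfold ee; constructor <;> linarith only [h_wx2.1, h_wx2.2, h_wy2.1, h_wy2.2]
  have h_ei : (64696589/250000000) ≤ ei c ∧ ei c ≤ (129393183/500000000) := invB h_ee (by norm_num)
  have h_pp : (111820451/1000000000) ≤ pp c ∧ pp c ≤ (55910233/500000000) := by
    unfold pp; constructor <;> linarith only [h_ei.1, h_ei.2]
  have h_p2 : (12503813/1000000000) ≤ p2 c ∧ p2 c ≤ (12503817/1000000000) := mulB h_pp h_pp (by norm_num)
  have h_k2 : (99253723/200000000) ≤ k2 c ∧ k2 c ≤ (49626863/100000000) := by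
    unfold k2
    refine sqB (a := (246282539/1000000000)) (b := (246282553/1000000000)) ⟨?_, ?_⟩ (by norm_num) <;> linarith only [h_ei.1, h_ei.2, h_p2.1, h_p2.2]
  have h_px : (-97444741/1000000000) ≤ px c ∧ px c ≤ (-48722361/500000000) := mulB h_pp h_wx (by norm_num)
  have h_py : (197032107/1000000000) ≤ py c ∧ py c ≤ (24629017/125000000) := mulB h_pp h_wy (by norm_num)
  have h_kx : (-432467953/1000000000) ≤ kx c ∧ kx c ≤ (-432467917/1000000000) := mulB h_k2 h_wx (by norm_num)
  have h_ky : (17488903/20000000) ≤ ky c ∧ ky c ≤ (174889037/200000000) := mulB h_k2 h_wy (by norm_num)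
  have h_xt : (564768999/200000000) ≤ xt c ∧ xt c ≤ (705961273/250000000) := by
    unfold xt; constructor <;> linarith only [h_xs.1, h_xs.2, h_px.1, h_px.2, h_ky.1, h_ky.2]
  have h_yt : (813804473/500000000) ≤ yt c ∧ yt c ≤ (81380451/50000000) := by
    unfold yt; constructor <;> linarith only [h_ys.1, h_ys.2, h_py.1, h_py.2, h_kx.1, h_kx.2]
  have h_rxt : (2445521501/500000000) ≤ rxt c ∧ rxt c ≤ (2445521587/500000000) := mulB h_rr h_xt (by norm_num)
  have h_ryt : (704775347/250000000) ≤ ryt c ∧ ryt c ≤ (2819101519/1000000000) := mulB h_rr h_yt (by norm_num)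
  have h_rxs : (110788713/31250000) ≤ rxs c ∧ rxs c ≤ (1772619447/500000000) := mulB h_rr h_xs (by norm_num)
  have h_rys : (1728775363/1000000000) ≤ rys c ∧ rys c ≤ (1728775381/1000000000) := mulB h_rr h_ys (by norm_num)
  have h_xf : (298043353/100000000) ≤ xf c ∧ xf c ≤ (745108413/250000000) := by
    unfold xf; constructor <;> linarith only [hc.1, hc.2, h_xt.1, h_xt.2, h_ryt.1, h_ryt.2, h_rs.1, h_rs.2]
  have h_yf : (1810734751/500000000) ≤ yf c ∧ yf c ≤ (56585463/15625000) := by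
    unfold yf; constructor <;> linarith only [h_ss.1, h_ss.2, h_yt.1, h_yt.2, h_rxt.1, h_rxt.2, h_rc.1, h_rc.2]
  have h_xv : (1490253897/500000000) ≤ xv c ∧ xv c ≤ (2980507939/1000000000) := by
    unfold xv; constructor <;> linarith only [h_xs.1, h_xs.2, h_xt.1, h_xt.2, h_ryt.1, h_ryt.2, h_rys.1, h_rys.2]
  have h_yv : (127991351/200000000) ≤ yv c ∧ yv c ≤ (319978461/500000000) := by
    unfold yv; constructor <;> linarith only [h_ys.1, h_ys.2, h_yt.1, h_yt.2, h_rxt.1, h_rxt.2, h_rxs.1, h_rxs.2]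
  have h_ff : (-74409/1000000000) ≤ ff c ∧ ff c ≤ (-37071/500000000) := by
    unfold ff; constructor <;> linarith only [h_xf.1, h_xf.2, h_xv.1, h_xv.2]
  exact h_ff

set_option maxHeartbeats 4000000 in
theorem bnd (c : ℝ) (hc : (3917817/10000000) ≤ c ∧ c ≤ (1959009/5000000)) :
    ((1732050807/1000000000) ≤ rr c ∧ rr c ≤ (216506351/125000000)) ∧
    ((230012411/250000000) ≤ ss c ∧ ss c ≤ (184011641/200000000)) ∧
    ((199196591/125000000) ≤ rs c ∧ rs c ≤ (796793779/500000000)) ∧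
    ((678585809/1000000000) ≤ rc c ∧ rc c ≤ (1085793/1600000)) ∧
    ((972120873/250000000) ≤ dd c ∧ dd c ≤ (972174469/250000000)) ∧
    ((8036109/31250000) ≤ di c ∧ di c ≤ (128584833/500000000)) ∧
    ((84590117/1000000000) ≤ k1 c ∧ k1 c ≤ (84673881/1000000000)) ∧
    ((2046662989/1000000000) ≤ xs c ∧ xs c ≤ (102343841/50000000)) ∧
    ((998093309/1000000000) ≤ ys c ∧ ys c ≤ (998133411/1000000000)) ∧
    ((1931894241/500000000) ≤ ee c ∧ ee c ≤ (966124517/250000000)) ∧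
    ((258765817/1000000000) ≤ ei c ∧ ei c ≤ (12940667/50000000)) ∧
    ((6247383/500000000) ≤ p2 c ∧ p2 c ≤ (3127677/250000000)) ∧
    ((2823565359/1000000000) ≤ xt c ∧ xt c ≤ (4412527/1562500)) ∧
    ((101712819/62500000) ≤ yt c ∧ yt c ≤ (813884967/500000000)) ∧
    ((1490062103/500000000) ≤ xf c ∧ xf c ≤ (745179629/250000000)) ∧
    ((3621125409/1000000000) ≤ yf c ∧ yf c ≤ (3621764267/1000000000)) ∧
    ((639540641/1000000000) ≤ yv c ∧ yv c ≤ (640319669/1000000000)) := by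
  have h_rr : (1732050807/1000000000) ≤ rr c ∧ rr c ≤ (216506351/125000000) := by
    unfold rr
    refine sqB (a := 3) (b := 3) ⟨?_, ?_⟩ (by norm_num) <;> linarith only []
  have h_cc : (1534929/10000000) ≤ cc c ∧ cc c ≤ (153508651/1000000000) := mulB hc hc (by norm_num)
  have h_ss : (230012411/250000000) ≤ ss c ∧ ss c ≤ (184011641/200000000) := by
    unfold ss
    refine sqB (a := (846491349/1000000000)) (b := (8465071/10000000)) ⟨?_, ?_⟩ (by norm_num) <;> linarith only [h_cc.1, h_cc.2]
  have h_rs : (199196591/125000000) ≤ rs c ∧ rs c ≤ (796793779/500000000) := mulB h_rr h_ss (by norm_num)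
  have h_rc : (678585809/1000000000) ≤ rc c ∧ rc c ≤ (1085793/1600000) := mulB h_rr hc (by norm_num)
  have h_s2 : (846491347/1000000000) ≤ s2 c ∧ s2 c ≤ (846507101/1000000000) := mulB h_ss h_ss (by norm_num)
  have h_rsc : (78041579/125000000) ≤ rsc c ∧ rsc c ≤ (312185237/500000000) := mulB h_rs hc (by norm_num)
  have h_dd : (972120873/250000000) ≤ dd c ∧ dd c ≤ (972174469/250000000) := by
    unfold dd; constructor <;> linarith only [h_s2.1, h_s2.2, h_rsc.1, h_rsc.2]
  have h_di : (8036109/31250000) ≤ di c ∧ di c ≤ (128584833/500000000) := invB h_dd (by norm_num)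
  have h_k1 : (84590117/1000000000) ≤ k1 c ∧ k1 c ≤ (84673881/1000000000) := by
    unfold k1
    refine sqB (a := (223609/31250000)) (b := (3584833/500000000)) ⟨?_, ?_⟩ (by norm_num) <;> linarith only [h_di.1, h_di.2]
  have h_ea : (1960813797/1000000000) ≤ ea c ∧ ea c ≤ (15319161/7812500) := by
    unfold ea; constructor <;> linarith only [h_ss.1, h_ss.2, h_rc.1, h_rc.2]
  have h_eb : (13067729/62500000) ≤ eb c ∧ eb c ≤ (209121229/1000000000) := by
    unfold eb; constructor <;> linarith only [h_rs.1, h_rs.2, hc.1, hc.2]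
  have h_ak : (41466367/250000000) ≤ ak c ∧ ak c ≤ (166033001/1000000000) := mulB h_ea h_k1 (by norm_num)
  have h_bk : (17686411/1000000000) ≤ bk c ∧ bk c ≤ (17707107/1000000000) := mulB h_eb h_k1 (by norm_num)
  have h_xs : (2046662989/1000000000) ≤ xs c ∧ xs c ≤ (102343841/50000000) := by
    unfold xs; constructor <;> linarith only [hc.1, hc.2, h_rs.1, h_rs.2, h_ak.1, h_ak.2]
  have h_ys : (998093309/1000000000) ≤ ys c ∧ ys c ≤ (998133411/1000000000) := by
    unfold ys; constructor <;> linarith only [h_ss.1, h_ss.2, h_rc.1, h_rc.2, h_bk.1, h_bk.2]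
  have h_wx : (-21788293/25000000) ≤ wx c ∧ wx c ≤ (-871257589/1000000000) := by
    unfold wx; constructor <;> linarith only [hc.1, hc.2, h_xs.1, h_xs.2]
  have h_wy : (1762015521/1000000000) ≤ wy c ∧ wy c ≤ (881040653/500000000) := by
    unfold wy; constructor <;> linarith only [h_ss.1, h_ss.2, h_ys.1, h_ys.2]
  have h_wx2 : (379544893/500000000) ≤ wx2 c ∧ wx2 c ≤ (759567539/1000000000) := mulB h_wx h_wx (by norm_num)
  have h_wy2 : (388087337/125000000) ≤ wy2 c ∧ wy2 c ≤ (3104930529/1000000000) := mulB h_wy h_wy (by norm_num)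
  have h_ee : (1931894241/500000000) ≤ ee c ∧ ee c ≤ (966124517/250000000) := by
    unfold ee; constructor <;> linarith only [h_wx2.1, h_wx2.2, h_wy2.1, h_wy2.2]
  have h_ei : (258765817/1000000000) ≤ ei c ∧ ei c ≤ (12940667/50000000) := invB h_ee (by norm_num)
  have h_pp : (11177999/100000000) ≤ pp c ∧ pp c ≤ (4474051/40000000) := by
    unfold pp; constructor <;> linarith only [h_ei.1, h_ei.2]
  have h_p2 : (6247383/500000000) ≤ p2 c ∧ p2 c ≤ (3127677/250000000) := mulB h_pp h_pp (by norm_num)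
  have h_k2 : (248120489/500000000) ≤ k2 c ∧ k2 c ≤ (496304921/1000000000) := by
    unfold k2
    refine sqB (a := (246255109/1000000000)) (b := (123159287/500000000)) ⟨?_, ?_⟩ (by norm_num) <;> linarith only [h_ei.1, h_ei.2, h_p2.1, h_p2.2]
  have h_px : (-19496387/200000000) ≤ px c ∧ px c ≤ (-24347291/250000000) := mulB h_pp h_wx (by norm_num)
  have h_py : (196958077/1000000000) ≤ py c ∧ py c ≤ (197091041/1000000000) := mulB h_pp h_wy (by norm_num)
  have h_kx : (-216272741/500000000) ≤ kx c ∧ kx c ≤ (-216176859/500000000) := mulB h_k2 h_wx (by norm_num)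
  have h_ky : (174876861/200000000) ≤ ky c ∧ ky c ≤ (109316203/125000000) := mulB h_k2 h_wy (by norm_num)
  have h_xt : (2823565359/1000000000) ≤ xt c ∧ xt c ≤ (4412527/1562500) := by
    unfold xt; constructor <;> linarith only [h_xs.1, h_xs.2, h_px.1, h_px.2, h_ky.1, h_ky.2]
  have h_yt : (101712819/62500000) ≤ yt c ∧ yt c ≤ (813884967/500000000) := by
    unfold yt; constructor <;> linarith only [h_ys.1, h_ys.2, h_py.1, h_py.2, h_kx.1, h_kx.2]
  have h_rxt : (2445279329/500000000) ≤ rxt c ∧ rxt c ≤ (1222835353/250000000) := mulB h_rr h_xt (by norm_num)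
  have h_ryt : (2818748323/1000000000) ≤ ryt c ∧ ryt c ≤ (281938023/100000000) := mulB h_rr h_yt (by norm_num)
  have h_rxs : (3544924281/1000000000) ≤ rxs c ∧ rxs c ≤ (70905893/20000000) := mulB h_rr h_xs (by norm_num)
  have h_rys : (1728748321/1000000000) ≤ rys c ∧ rys c ≤ (864408891/500000000) := mulB h_rr h_ys (by norm_num)
  have h_xf : (1490062103/500000000) ≤ xf c ∧ xf c ≤ (745179629/250000000) := by
    unfold xf; constructor <;> linarith only [hc.1, hc.2, h_xt.1, h_xt.2, h_ryt.1, h_ryt.2, h_rs.1, h_rs.2]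
  have h_yf : (3621125409/1000000000) ≤ yf c ∧ yf c ≤ (3621764267/1000000000) := by
    unfold yf; constructor <;> linarith only [h_ss.1, h_ss.2, h_yt.1, h_yt.2, h_rxt.1, h_rxt.2, h_rc.1, h_rc.2]
  have h_xv : (745019861/250000000) ≤ xv c ∧ xv c ≤ (596152601/200000000) := by
    unfold xv; constructor <;> linarith only [h_xs.1, h_xs.2, h_xt.1, h_xt.2, h_ryt.1, h_ryt.2, h_rys.1, h_rys.2]
  have h_yv : (639540641/1000000000) ≤ yv c ∧ yv c ≤ (640319669/1000000000) := by
    unfold yv; constructor <;> linarith only [h_ys.1, h_ys.2, h_yt.1, h_yt.2, h_rxt.1, h_rxt.2, h_rxs.1, h_rxs.2]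
  have h_ff : (-638799/1000000000) ≤ ff c ∧ ff c ≤ (19971/31250000) := by
    unfold ff; constructor <;> linarith only [h_xf.1, h_xf.2, h_xv.1, h_xv.2]
  exact ⟨h_rr, h_ss, h_rs, h_rc, h_dd, h_di, h_k1, h_xs, h_ys, h_ee, h_ei, h_p2, h_xt, h_yt, h_xf, h_yf, h_yv⟩

theorem contAll : ContinuousOn ff (Set.Icc (3917817/10000000) (1959009/5000000)) := by
  have h_c : ContinuousOn (fun c : ℝ => c) (Set.Icc (3917817/10000000) (1959009/5000000)) := continuousOn_id
  have h_rr : ContinuousOn rr (Set.Icc (3917817/10000000) (1959009/5000000)) := continuousOn_const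
  have h_cc : ContinuousOn cc (Set.Icc (3917817/10000000) (1959009/5000000)) := h_c.mul h_c
  have h_ss : ContinuousOn ss (Set.Icc (3917817/10000000) (1959009/5000000)) := (continuousOn_const.add (continuousOn_const.mul h_cc)).sqrt
  have h_rs : ContinuousOn rs (Set.Icc (3917817/10000000) (1959009/5000000)) := h_rr.mul h_ss
  have h_rc : ContinuousOn rc (Set.Icc (3917817/10000000) (1959009/5000000)) := h_rr.mul h_c
  have h_s2 : ContinuousOn s2 (Set.Icc (3917817/10000000) (1959009/5000000)) := h_ss.mul h_ss
  have h_rsc : ContinuousOn rsc (Set.Icc (3917817/10000000) (1959009/5000000)) := h_rs.mul h_c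
  have h_dd : ContinuousOn dd (Set.Icc (3917817/10000000) (1959009/5000000)) := ((continuousOn_const.add (continuousOn_const.mul h_s2)).add (continuousOn_const.mul h_rsc))
  have h_di : ContinuousOn di (Set.Icc (3917817/10000000) (1959009/5000000)) := h_dd.inv₀ (fun c hc => by
      have := (bnd c hc).2.2.2.2.1.1
      intro h0; rw [h0] at this; norm_num at this)
  have h_k1 : ContinuousOn k1 (Set.Icc (3917817/10000000) (1959009/5000000)) := ((continuousOn_const.mul h_di).add continuousOn_const).sqrt
  have h_ea : ContinuousOn ea (Set.Icc (3917817/10000000) (1959009/5000000)) := ((continuousOn_const.mul h_ss).add (continuousOn_const.mul h_rc))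
  have h_eb : ContinuousOn eb (Set.Icc (3917817/10000000) (1959009/5000000)) := ((continuousOn_const.mul h_rs).add (continuousOn_const.mul h_c))
  have h_ak : ContinuousOn ak (Set.Icc (3917817/10000000) (1959009/5000000)) := h_ea.mul h_k1
  have h_bk : ContinuousOn bk (Set.Icc (3917817/10000000) (1959009/5000000)) := h_eb.mul h_k1
  have h_xs : ContinuousOn xs (Set.Icc (3917817/10000000) (1959009/5000000)) := (((continuousOn_const.mul h_c).add (continuousOn_const.mul h_rs)).add (continuousOn_const.mul h_ak))
  have h_ys : ContinuousOn ys (Set.Icc (3917817/10000000) (1959009/5000000)) := (((continuousOn_const.mul h_ss).add (continuousOn_const.mul h_rc)).add (continuousOn_const.mul h_bk))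
  have h_wx : ContinuousOn wx (Set.Icc (3917817/10000000) (1959009/5000000)) := ((continuousOn_const.mul h_c).add (continuousOn_const.mul h_xs))
  have h_wy : ContinuousOn wy (Set.Icc (3917817/10000000) (1959009/5000000)) := ((continuousOn_const.mul h_ss).add (continuousOn_const.mul h_ys))
  have h_wx2 : ContinuousOn wx2 (Set.Icc (3917817/10000000) (1959009/5000000)) := h_wx.mul h_wx
  have h_wy2 : ContinuousOn wy2 (Set.Icc (3917817/10000000) (1959009/5000000)) := h_wy.mul h_wy
  have h_ee : ContinuousOn ee (Set.Icc (3917817/10000000) (1959009/5000000)) := ((continuousOn_const.mul h_wx2).add (continuousOn_const.mul h_wy2))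
  have h_ei : ContinuousOn ei (Set.Icc (3917817/10000000) (1959009/5000000)) := h_ee.inv₀ (fun c hc => by
      have := (bnd c hc).2.2.2.2.2.2.2.2.2.1.1
      intro h0; rw [h0] at this; norm_num at this)
  have h_pp : ContinuousOn pp (Set.Icc (3917817/10000000) (1959009/5000000)) := (continuousOn_const.add (continuousOn_const.mul h_ei))
  have h_p2 : ContinuousOn p2 (Set.Icc (3917817/10000000) (1959009/5000000)) := h_pp.mul h_pp
  have h_k2 : ContinuousOn k2 (Set.Icc (3917817/10000000) (1959009/5000000)) := ((continuousOn_const.mul h_ei).add (continuousOn_const.mul h_p2)).sqrt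
  have h_px : ContinuousOn px (Set.Icc (3917817/10000000) (1959009/5000000)) := h_pp.mul h_wx
  have h_py : ContinuousOn py (Set.Icc (3917817/10000000) (1959009/5000000)) := h_pp.mul h_wy
  have h_kx : ContinuousOn kx (Set.Icc (3917817/10000000) (1959009/5000000)) := h_k2.mul h_wx
  have h_ky : ContinuousOn ky (Set.Icc (3917817/10000000) (1959009/5000000)) := h_k2.mul h_wy
  have h_xt : ContinuousOn xt (Set.Icc (3917817/10000000) (1959009/5000000)) := (((continuousOn_const.mul h_xs).add (continuousOn_const.mul h_px)).add (continuousOn_const.mul h_ky))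
  have h_yt : ContinuousOn yt (Set.Icc (3917817/10000000) (1959009/5000000)) := (((continuousOn_const.mul h_ys).add (continuousOn_const.mul h_py)).add (continuousOn_const.mul h_kx))
  have h_rxt : ContinuousOn rxt (Set.Icc (3917817/10000000) (1959009/5000000)) := h_rr.mul h_xt
  have h_ryt : ContinuousOn ryt (Set.Icc (3917817/10000000) (1959009/5000000)) := h_rr.mul h_yt
  have h_rxs : ContinuousOn rxs (Set.Icc (3917817/10000000) (1959009/5000000)) := h_rr.mul h_xs
  have h_rys : ContinuousOn rys (Set.Icc (3917817/10000000) (1959009/5000000)) := h_rr.mul h_ys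
  have h_xf : ContinuousOn xf (Set.Icc (3917817/10000000) (1959009/5000000)) := ((((continuousOn_const.mul h_c).add (continuousOn_const.mul h_xt)).add (continuousOn_const.mul h_ryt)).add (continuousOn_const.mul h_rs))
  have h_yf : ContinuousOn yf (Set.Icc (3917817/10000000) (1959009/5000000)) := ((((continuousOn_const.mul h_ss).add (continuousOn_const.mul h_yt)).add (continuousOn_const.mul h_rxt)).add (continuousOn_const.mul h_rc))
  have h_xv : ContinuousOn xv (Set.Icc (3917817/10000000) (1959009/5000000)) := ((((continuousOn_const.mul h_xs).add (continuousOn_const.mul h_xt)).add (continuousOn_const.mul h_ryt)).add (continuousOn_const.mul h_rys))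
  have h_yv : ContinuousOn yv (Set.Icc (3917817/10000000) (1959009/5000000)) := ((((continuousOn_const.mul h_ys).add (continuousOn_const.mul h_yt)).add (continuousOn_const.mul h_rxt)).add (continuousOn_const.mul h_rxs))
  have h_ff : ContinuousOn ff (Set.Icc (3917817/10000000) (1959009/5000000)) := ((continuousOn_const.mul h_xf).add (continuousOn_const.mul h_xv))
  exact h_ff

def AX : Fin 15 → ℤ := ![-2589, -2197, -1805, -1988, -1596, -1204, -934, -157, -981, -903, -78, -2980, -995, 0, 0]
def AY : Fin 15 → ℤ := ![920, 1840, 2760, 121, 1041, 1961, 998, 1628, 2194, 3191, 2625, 0, 0, 3621, 640]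
def QE : List (Fin 15 × Fin 15) := [(11, 0), (0, 1), (11, 3), (0, 3), (1, 2), (0, 4), (1, 4), (3, 4), (1, 5), (2, 5), (4, 5), (3, 12), (2, 8), (5, 6), (12, 6), (2, 9), (8, 9), (8, 7), (6, 7), (8, 10), (9, 10), (7, 10), (9, 13), (10, 13), (6, 14), (7, 14)]

theorem alg (c s r D di k1 x1 y1 wx wy e ei p k2 x2 y2 X y3 x4 y4 : ℝ)
    (hu : c ^ 2 + s ^ 2 = 1) (hr : r ^ 2 = 3)
    (hD : D = 3 + 4 * s ^ 2 - 4 * r * s * c) (hdi : D * di = 1) (hk1 : k1 ^ 2 = di - 1 / 4)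
    (hx1 : x1 = 7 / 4 * c + 3 / 4 * (r * s) + (5 / 2 * s - r * c / 2) * k1)
    (hy1 : y1 = 5 / 4 * s - 1 / 4 * (r * c) + (r * s / 2 - 3 / 2 * c) * k1)
    (hwx : wx = 3 * c - x1) (hwy : wy = 3 * s - y1) (he : e = wx ^ 2 + wy ^ 2)
    (hei : e * ei = 1) (hp : p = 1 / 2 - 3 / 2 * ei) (hk2 : k2 ^ 2 = ei - p ^ 2)
    (hx2 : x2 = x1 + p * wx + k2 * wy) (hy2 : y2 = y1 + p * wy - k2 * wx)
    (hX : X = 3 / 2 * c + 1 / 2 * x2 - 1 / 2 * (r * y2) + 3 / 2 * (r * s))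
    (hy3 : y3 = 3 / 2 * s + 1 / 2 * y2 + 1 / 2 * (r * x2) - 3 / 2 * (r * c))
    (hx4 : x4 = 1 / 2 * x1 + 1 / 2 * x2 + 1 / 2 * (r * y2) - 1 / 2 * (r * y1))
    (hy4 : y4 = 1 / 2 * y1 + 1 / 2 * y2 - 1 / 2 * (r * x2) + 1 / 2 * (r * x1))
    (qx qy : Fin 15 → ℝ)
    (hqx : qx = ![c - X, 2 * c - X, 3 * c - X, (c + r * s) / 2 - X, (c + r * s) / 2 + c - X, (c + r * s) / 2 + 2 * c - X, x1 - X, x2 - X, (3 * c + x2) / 2 - X, (3 * c + X) / 2 - X, (x2 + X) / 2 - X, 0 - X, c + r * s - X, X - X, x4 - X])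
    (hqy : qy = ![s, 2 * s, 3 * s, (s - r * c) / 2, (s - r * c) / 2 + s, (s - r * c) / 2 + 2 * s, y1, y2, (3 * s + y2) / 2, (3 * s + y3) / 2, (y2 + y3) / 2, 0, 0, y3, y4]) :
    ∀ z ∈ QE, (qx z.1 - qx z.2) ^ 2 + (qy z.1 - qy z.2) ^ 2 = 1 := by
  have hd : (r * s / 2 - 3 / 2 * c) ^ 2 + (5 / 2 * s - r * c / 2) ^ 2 = D := by
    rw [hD]; linear_combination (3 : ℝ) * hu + (s ^ 2 / 4 + c ^ 2 / 4) * hr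
  have hdk : D * (1 / 4 + k1 ^ 2) = 1 := by rw [hk1]; linear_combination hdi
  have h1 : (x1 - ((c + r * s) / 2 + 2 * c)) ^ 2 + (y1 - ((s - r * c) / 2 + 2 * s)) ^ 2 = 1 := by
    rw [hx1, hy1]; linear_combination (1 / 4 + k1 ^ 2) * hd + hdk
  have h2 : (x1 - (c + r * s)) ^ 2 + y1 ^ 2 = 1 := by
    rw [hx1, hy1]; linear_combination (1 / 4 + k1 ^ 2) * hd + hdk
  have h3 : (x2 - x1) ^ 2 + (y2 - y1) ^ 2 = 1 := by
    rw [hx2, hy2]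
    linear_combination (-(p ^ 2 + k2 ^ 2)) * he + e * hk2 + hei
  have h4 : (x2 - 3 * c) ^ 2 + (y2 - 3 * s) ^ 2 = 4 := by
    have a : x2 - 3 * c = (p - 1) * wx + k2 * wy := by rw [hx2, hwx]; ring
    have b : y2 - 3 * s = (p - 1) * wy - k2 * wx := by rw [hy2, hwy]; ring
    rw [a, b]
    linear_combination (-((p - 1) ^ 2 + k2 ^ 2)) * he + e * hk2 + 4 * hei - 2 * e * hp
  clear hx1 hy1 hx2 hy2 hwx hwy he hei hp hk2 hk1 hD hd hdk hdi
  subst hX hy3 hx4 hy4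
  intro z hz
  subst hqx hqy
  unfold QE at hz
  fin_cases hz <;> simp <;> first
    | linear_combination hu
    | linear_combination (1 + r ^ 2) / 4 * hu + 1 / 4 * hr
    | linear_combination h1
    | linear_combination h2
    | linear_combination h3
    | linear_combination (1 + r ^ 2) / 4 * h3 + 1 / 4 * hr
    | linear_combination 1 / 4 * h4
    | linear_combination (1 + r ^ 2) / 16 * h4 + 1 / 4 * hr

set_option maxHeartbeats 4000000 in
theorem quarter : ∃ qx qy : Fin 15 → ℝ,
    (∀ i, |1000 * qx i - AX i| ≤ 3) ∧ (∀ i, |1000 * qy i - AY i| ≤ 3) ∧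
    qy 11 = 0 ∧ qy 12 = 0 ∧ qx 13 = 0 ∧ qx 14 = 0 ∧
    ∀ z ∈ QE, (qx z.1 - qx z.2) ^ 2 + (qy z.1 - qy z.2) ^ 2 = 1 := by
  have h0 : (0 : ℝ) ∈ Set.Icc (ff (1959009/5000000)) (ff (3917817/10000000)) :=
    ⟨by linarith [(bnd1 (1959009/5000000) ⟨le_refl _, le_refl _⟩).2], by linarith [(bnd0 (3917817/10000000) ⟨le_refl _, le_refl _⟩).1]⟩
  obtain ⟨c, hc, hf⟩ := intermediate_value_Icc' (by norm_num) contAll h0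
  obtain ⟨b_rr, b_ss, b_rs, b_rc, b_dd, b_di, b_k1, b_xs, b_ys, b_ee, b_ei, b_p2, b_xt, b_yt, b_xf,
    b_yf, b_yv⟩ := bnd c hc
  have hcc : cc c = c * c := rfl
  have hxv : xv c = xf c := by unfold ff at hf; linarith
  refine ⟨![c - xf c, 2 * c - xf c, 3 * c - xf c, (c + rr c * ss c) / 2 - xf c, (c + rr c * ss c) / 2 + c - xf c, (c + rr c * ss c) / 2 + 2 * c - xf c, xs c - xf c, xt c - xf c, (3 * c + xt c) / 2 - xf c, (3 * c + xf c) / 2 - xf c, (xt c + xf c) / 2 - xf c, 0 - xf c, c + rr c * ss c - xf c, xf c - xf c, xv c - xf c],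
    ![ss c, 2 * ss c, 3 * ss c, (ss c - rr c * c) / 2, (ss c - rr c * c) / 2 + ss c, (ss c - rr c * c) / 2 + 2 * ss c, ys c, yt c, (3 * ss c + yt c) / 2, (3 * ss c + yf c) / 2, (yt c + yf c) / 2, 0, 0, yf c, yv c], ?_, ?_, ?_, ?_, ?_, ?_, ?_⟩
  case refine_7 =>
    refine alg c (ss c) (rr c) (dd c) (di c) (k1 c) (xs c) (ys c) (wx c) (wy c) (ee c) (ei c) (pp c)
      (k2 c) (xt c) (yt c) (xf c) (yf c) (xv c) (yv c) ?_ ?_ ?_ ?_ ?_ ?_ ?_ ?_ ?_ ?_ ?_ ?_ ?_ ?_ ?_ ?_ ?_ ?_ ?_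
      _ _ rfl rfl
    · unfold ss; rw [Real.sq_sqrt]
      · rw [hcc]; ring
      · rw [hcc]; nlinarith [hc.1, hc.2]
    · unfold rr; rw [Real.sq_sqrt] <;> norm_num
    · simp only [dd, s2, rsc, rs]; ring
    · rw [di, mul_inv_cancel₀]; intro h; rw [h] at b_dd; norm_num at b_dd
    · rw [k1, Real.sq_sqrt]
      · ring
      · linarith only [b_di.1]
    · simp only [xs, rs, rc, ak, ea]; ring
    · simp only [ys, rs, rc, bk, eb]; ring
    · simp only [wx]; ring
    · simp only [wy]; ring
    · simp only [ee, wx2, wy2]; ring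
    · rw [ei, mul_inv_cancel₀]; intro h; rw [h] at b_ee; norm_num at b_ee
    · simp only [pp]; ring
    · rw [k2, Real.sq_sqrt]
      · simp only [p2]; ring
      · linarith only [b_ei.1, b_p2.2]
    · simp only [xt, px, ky]; ring
    · simp only [yt, py, kx]; ring
    · simp only [xf, ryt, rs]; ring
    · simp only [yf, rxt, rc]; ring
    · simp only [xv, ryt, rys]; ring
    · simp only [yv, rxt, rxs]; ring
  case refine_1 =>
    have e1 : rr c * ss c = rs c := rfl
    simp only [e1]
    obtain ⟨hc1, hc2⟩ := hc
    clear hf h0 b_dd b_di b_k1 b_ee b_ei b_p2 b_rr hcc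
    intro i
    rw [abs_le]
    fin_cases i <;> simp [AX] <;> constructor <;> linarith
  case refine_2 =>
    have e1 : rr c * c = rc c := rfl
    simp only [e1]
    obtain ⟨hc1, hc2⟩ := hc
    clear hf h0 b_dd b_di b_k1 b_ee b_ei b_p2 b_rr hcc
    intro i
    rw [abs_le]
    fin_cases i <;> simp [AY] <;> constructor <;> linarith
  all_goals simp [hxv]

abbrev Row := (Fin 52 × Fin 52) × (ℕ × ℕ) × (ℕ × ℕ)

def rows : List Row := [
  ((0, 44), (1411, 4920), (1020, 4000)),
  ((1, 44), (1411, 3080), (1020, 4000)),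
  ((2, 45), (6589, 4920), (6980, 4000)),
  ((3, 45), (6589, 3080), (6980, 4000)),
  ((0, 4), (1411, 4920), (1803, 5840)),
  ((1, 5), (1411, 3080), (1803, 2160)),
  ((2, 6), (6589, 4920), (6197, 5840)),
  ((3, 7), (6589, 3080), (6197, 2160)),
  ((12, 44), (2012, 4121), (1020, 4000)),
  ((13, 44), (2012, 3879), (1020, 4000)),
  ((14, 45), (5988, 4121), (6980, 4000)),
  ((15, 45), (5988, 3879), (6980, 4000)),
  ((0, 12), (1411, 4920), (2012, 4121)),
  ((1, 13), (1411, 3080), (2012, 3879)),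
  ((2, 14), (6589, 4920), (5988, 4121)),
  ((3, 15), (6589, 3080), (5988, 3879)),
  ((4, 8), (1803, 5840), (2195, 6760)),
  ((5, 9), (1803, 2160), (2195, 1240)),
  ((6, 10), (6197, 5840), (5805, 6760)),
  ((7, 11), (6197, 2160), (5805, 1240)),
  ((0, 16), (1411, 4920), (2404, 5041)),
  ((1, 17), (1411, 3080), (2404, 2959)),
  ((2, 18), (6589, 4920), (5596, 5041)),
  ((3, 19), (6589, 3080), (5596, 2959)),
  ((4, 16), (1803, 5840), (2404, 5041)),
  ((5, 17), (1803, 2160), (2404, 2959)),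
  ((6, 18), (6197, 5840), (5596, 5041)),
  ((7, 19), (6197, 2160), (5596, 2959)),
  ((12, 16), (2012, 4121), (2404, 5041)),
  ((13, 17), (2012, 3879), (2404, 2959)),
  ((14, 18), (5988, 4121), (5596, 5041)),
  ((15, 19), (5988, 3879), (5596, 2959)),
  ((4, 20), (1803, 5840), (2796, 5961)),
  ((5, 21), (1803, 2160), (2796, 2039)),
  ((6, 22), (6197, 5840), (5204, 5961)),
  ((7, 23), (6197, 2160), (5204, 2039)),
  ((8, 20), (2195, 6760), (2796, 5961)),
  ((9, 21), (2195, 1240), (2796, 2039)),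
  ((10, 22), (5805, 6760), (5204, 5961)),
  ((11, 23), (5805, 1240), (5204, 2039)),
  ((16, 20), (2404, 5041), (2796, 5961)),
  ((17, 21), (2404, 2959), (2796, 2039)),
  ((18, 22), (5596, 5041), (5204, 5961)),
  ((19, 23), (5596, 2959), (5204, 2039)),
  ((12, 46), (2012, 4121), (3005, 4000)),
  ((13, 46), (2012, 3879), (3005, 4000)),
  ((14, 47), (5988, 4121), (4995, 4000)),
  ((15, 47), (5988, 3879), (4995, 4000)),
  ((8, 32), (2195, 6760), (3019, 6194)),
  ((9, 33), (2195, 1240), (3019, 1806)),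
  ((10, 34), (5805, 6760), (4981, 6194)),
  ((11, 35), (5805, 1240), (4981, 1806)),
  ((20, 24), (2796, 5961), (3066, 4998)),
  ((21, 25), (2796, 2039), (3066, 3002)),
  ((22, 26), (5204, 5961), (4934, 4998)),
  ((23, 27), (5204, 2039), (4934, 3002)),
  ((24, 46), (3066, 4998), (3005, 4000)),
  ((25, 46), (3066, 3002), (3005, 4000)),
  ((26, 47), (4934, 4998), (4995, 4000)),
  ((27, 47), (4934, 3002), (4995, 4000)),
  ((8, 36), (2195, 6760), (3097, 7191)),
  ((9, 37), (2195, 1240), (3097, 809)),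
  ((10, 38), (5805, 6760), (4903, 7191)),
  ((11, 39), (5805, 1240), (4903, 809)),
  ((32, 36), (3019, 6194), (3097, 7191)),
  ((33, 37), (3019, 1806), (3097, 809)),
  ((34, 38), (4981, 6194), (4903, 7191)),
  ((35, 39), (4981, 1806), (4903, 809)),
  ((28, 32), (3843, 5628), (3019, 6194)),
  ((29, 33), (3843, 2372), (3019, 1806)),
  ((30, 34), (4157, 5628), (4981, 6194)),
  ((31, 35), (4157, 2372), (4981, 1806)),
  ((24, 28), (3066, 4998), (3843, 5628)),
  ((25, 29), (3066, 3002), (3843, 2372)),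
  ((26, 30), (4934, 4998), (4157, 5628)),
  ((27, 31), (4934, 3002), (4157, 2372)),
  ((32, 40), (3019, 6194), (3922, 6625)),
  ((33, 41), (3019, 1806), (3922, 1375)),
  ((34, 42), (4981, 6194), (4078, 6625)),
  ((35, 43), (4981, 1806), (4078, 1375)),
  ((36, 40), (3097, 7191), (3922, 6625)),
  ((37, 41), (3097, 809), (3922, 1375)),
  ((38, 42), (4903, 7191), (4078, 6625)),
  ((39, 43), (4903, 809), (4078, 1375)),
  ((28, 40), (3843, 5628), (3922, 6625)),
  ((29, 41), (3843, 2372), (3922, 1375)),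
  ((30, 42), (4157, 5628), (4078, 6625)),
  ((31, 43), (4157, 2372), (4078, 1375)),
  ((36, 48), (3097, 7191), (3980, 7661)),
  ((37, 49), (3097, 809), (4000, 379)),
  ((38, 48), (4903, 7191), (3980, 7661)),
  ((39, 49), (4903, 809), (4000, 379)),
  ((40, 48), (3922, 6625), (3980, 7661)),
  ((41, 49), (3922, 1375), (4000, 379)),
  ((42, 48), (4078, 6625), (3980, 7661)),
  ((43, 49), (4078, 1375), (4000, 379)),
  ((24, 50), (3066, 4998), (4000, 4640)),
  ((25, 51), (3066, 3002), (4000, 3360)),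
  ((26, 50), (4934, 4998), (4000, 4640)),
  ((27, 51), (4934, 3002), (4000, 3360)),
  ((28, 50), (3843, 5628), (4000, 4640)),
  ((29, 51), (3843, 2372), (4000, 3360)),
  ((30, 50), (4157, 5628), (4000, 4640)),
  ((31, 51), (4157, 2372), (4000, 3360))]

def enc (i : Fin 15) (a b : Bool) : Fin 52 :=
  if i.val < 11 then Fin.ofNat 52 (4 * i.val + (2 * a.toNat + b.toNat))
  else Fin.ofNat 52 (44 + (2 * (i.val - 11) + (if i.val < 13 then a.toNat else b.toNat)))

def idx (v : Fin 52) : Fin 15 :=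
  if v.val < 44 then Fin.ofNat 15 (v.val / 4) else Fin.ofNat 15 (11 + (v.val - 44) / 2)

def fx (v : Fin 52) : Bool :=
  if v.val < 44 then Nat.beq (v.val % 4 / 2) 1
  else if v.val < 48 then Nat.beq (v.val % 2) 1 else false

def fy (v : Fin 52) : Bool :=
  if v.val < 44 then Nat.beq (v.val % 2) 1
  else if v.val < 48 then false else Nat.beq (v.val % 2) 1

def XA (v : Fin 52) : ℤ :=
  if v = 48 then 3980 else if fx v then 4000 - AX (idx v) else 4000 + AX (idx v)

def YA (v : Fin 52) : ℤ :=
  if v = 48 then 7661 else if fy v then 4000 - AY (idx v) else 4000 + AY (idx v)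

def sgn (b : Bool) : ℝ := if b then -1 else 1

/-! combinatorial checks -/

def lt4 (k a b c d : ℕ) : Bool :=
  Nat.ble (a + k) c && (Nat.ble (a + k) d && (Nat.ble (b + k) c && Nat.ble (b + k) d))

def sepB (e f : Row) : Bool :=
  lt4 11 e.2.1.1 e.2.2.1 f.2.1.1 f.2.2.1 || (lt4 11 e.2.1.2 e.2.2.2 f.2.1.2 f.2.2.2 ||
  (lt4 21 (e.2.1.1 + e.2.1.2) (e.2.2.1 + e.2.2.2) (f.2.1.1 + f.2.1.2) (f.2.2.1 + f.2.2.2) ||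
  lt4 21 (e.2.1.1 + (10000 - e.2.1.2)) (e.2.2.1 + (10000 - e.2.2.2))
    (f.2.1.1 + (10000 - f.2.1.2)) (f.2.2.1 + (10000 - f.2.2.2))))

def adjZ (ax ay vx vy bx by' : ℤ) : Bool :=
  decide (10 * (|bx - ax| + |by' - ay|) < (bx - ax) * (vx - ax) + (by' - ay) * (vy - ay)) &&
  decide (10 * (|bx - ax| + |by' - ay|) < (bx - ax) * (bx - vx) + (by' - ay) * (by' - vy))

def adjN (a v b : ℕ × ℕ) : Bool := adjZ a.1 a.2 v.1 v.2 b.1 b.2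

def eqF (a b : Fin 52) : Bool := Nat.beq a.val b.val

def adjB (e f : Row) : Bool :=
  (eqF e.1.1 f.1.1 && adjN e.2.2 e.2.1 f.2.2) || ((eqF e.1.1 f.1.2 && adjN e.2.2 e.2.1 f.2.1) ||
  ((eqF e.1.2 f.1.1 && adjN e.2.1 e.2.2 f.2.2) || (eqF e.1.2 f.1.2 && adjN e.2.1 e.2.2 f.2.1)))

def same (e f : Row) : Bool := eqF e.1.1 f.1.1 && eqF e.1.2 f.1.2

def chk (e f : Row) : Bool := sepB e f || (sepB f e || (same e f || adjB e f))

theorem chk_all : (rows.all fun e => rows.all fun f => chk e f) = true := by decide +kernel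

theorem rows_ok : ∀ w ∈ rows, ((w.2.1.1 : ℤ) = XA w.1.1 ∧ (w.2.1.2 : ℤ) = YA w.1.1) ∧
    ((w.2.2.1 : ℤ) = XA w.1.2 ∧ (w.2.2.2 : ℤ) = YA w.1.2) ∧ w.2.1.2 ≤ 10000 ∧ w.2.2.2 ≤ 10000 := by
  decide +kernel

def EE : Finset (Fin 52 × Fin 52) := (rows.map Prod.fst).toFinset

def bad : List (Fin 52 × Fin 52) := [(38, 48), (40, 48), (42, 48)]

theorem EE_lt : ∀ w ∈ rows, w.1.1 < w.1.2 := by decide +kernel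
theorem EE_card : EE.card = 104 := by decide +kernel
theorem EE_deg : ∀ v : Fin 52, (EE.filter (fun e => e.1 = v ∨ e.2 = v)).card = 4 := by decide +kernel
theorem EE_bad : (EE.filter (fun e => e ∉ bad)).card = 101 := by decide +kernel

def bools : List (Bool × Bool) := [(false, false), (false, true), (true, false), (true, true)]

theorem EE_unit : ∀ w ∈ rows, (w.1 ∈ bad ∨ w.1 = (36, 48)) ∨ ∃ z ∈ QE, ∃ s ∈ bools,
    enc z.1 s.1 s.2 ≠ 48 ∧ enc z.2 s.1 s.2 ≠ 48 ∧
    (w.1 = (enc z.1 s.1 s.2, enc z.2 s.1 s.2) ∨ w.1 = (enc z.2 s.1 s.2, enc z.1 s.1 s.2)) := by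
  decide +kernel

theorem enc_ok : ∀ i : Fin 15, ∀ a b : Bool, idx (enc i a b) = i ∧
    (fx (enc i a b) = a ∨ i = 13 ∨ i = 14) ∧ (fy (enc i a b) = b ∨ i = 11 ∨ i = 12) := by
  decide +kernel

theorem XY_inj : ∀ v w : Fin 52, v ≠ w → (XA v + 10 < XA w ∨ XA w + 10 < XA v) ∨
    (YA v + 10 < YA w ∨ YA w + 10 < YA v) := by decide +kernel

theorem sgn_sq (b : Bool) : sgn b ^ 2 = 1 := by cases b <;> simp [sgn]

/-- A linear functional `l x + m y` separates the two segments. -/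
def SepP (x y : Fin 52 → ℝ) (a b c d : Fin 52) : Prop :=
  ∃ l m : ℝ, l * x a + m * y a < l * x c + m * y c ∧ l * x a + m * y a < l * x d + m * y d ∧
    l * x b + m * y b < l * x c + m * y c ∧ l * x b + m * y b < l * x d + m * y d

def AdjP (x y : Fin 52 → ℝ) (a v b : Fin 52) : Prop :=
  ∃ l m : ℝ, l * x a + m * y a < l * x v + m * y v ∧ l * x v + m * y v < l * x b + m * y b

theorem lt4_iff (k a b c d : ℕ) (h : lt4 k a b c d = true) :
    ((a : ℝ) + k ≤ c ∧ (a : ℝ) + k ≤ d) ∧ ((b : ℝ) + k ≤ c ∧ (b : ℝ) + k ≤ d) := by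
  simp only [lt4, Bool.and_eq_true, Nat.ble_eq] at h
  obtain ⟨h1, h2, h3, h4⟩ := h
  refine ⟨⟨?_, ?_⟩, ?_, ?_⟩ <;> exact_mod_cast by assumption

theorem sep_sound (x y : Fin 52 → ℝ) (e f : Row)
    (e1 : |1000 * x e.1.1 + 4000 - e.2.1.1| ≤ 5) (e2 : |1000 * y e.1.1 + 4000 - e.2.1.2| ≤ 5)
    (e3 : |1000 * x e.1.2 + 4000 - e.2.2.1| ≤ 5) (e4 : |1000 * y e.1.2 + 4000 - e.2.2.2| ≤ 5)
    (f1 : |1000 * x f.1.1 + 4000 - f.2.1.1| ≤ 5) (f2 : |1000 * y f.1.1 + 4000 - f.2.1.2| ≤ 5)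
    (f3 : |1000 * x f.1.2 + 4000 - f.2.2.1| ≤ 5) (f4 : |1000 * y f.1.2 + 4000 - f.2.2.2| ≤ 5)
    (ge1 : e.2.1.2 ≤ 10000) (ge2 : e.2.2.2 ≤ 10000) (gf1 : f.2.1.2 ≤ 10000)
    (gf2 : f.2.2.2 ≤ 10000) (h : sepB e f = true) : SepP x y e.1.1 e.1.2 f.1.1 f.1.2 := by
  rw [abs_le] at e1 e2 e3 e4 f1 f2 f3 f4
  simp only [sepB, Bool.or_eq_true] at h
  rcases h with h | h | h | h
  · have := lt4_iff _ _ _ _ _ h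
    push_cast at this
    exact ⟨1, 0, by linarith, by linarith, by linarith, by linarith⟩
  · have := lt4_iff _ _ _ _ _ h
    push_cast at this
    exact ⟨0, 1, by linarith, by linarith, by linarith, by linarith⟩
  · have := lt4_iff _ _ _ _ _ h
    push_cast at this
    exact ⟨1, 1, by linarith, by linarith, by linarith, by linarith⟩
  · have := lt4_iff _ _ _ _ _ h
    push_cast [Nat.cast_sub ge1, Nat.cast_sub ge2, Nat.cast_sub gf1, Nat.cast_sub gf2] at this
    exact ⟨1, -1, by linarith, by linarith, by linarith, by linarith⟩

theorem mul_err (L u U : ℝ) (h : |u - U| ≤ 10) : L * U - 10 * |L| ≤ L * u := by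
  have h1 : |L * (u - U)| ≤ |L| * 10 := by
    rw [abs_mul]; exact mul_le_mul_of_nonneg_left h (abs_nonneg _)
  have := (abs_le.1 h1).1
  linarith

theorem adj_sound (x y : Fin 52 → ℝ) (a v b : Fin 52) (A W B : ℕ × ℕ)
    (a1 : |1000 * x a + 4000 - A.1| ≤ 5) (a2 : |1000 * y a + 4000 - A.2| ≤ 5)
    (v1 : |1000 * x v + 4000 - W.1| ≤ 5) (v2 : |1000 * y v + 4000 - W.2| ≤ 5)
    (b1 : |1000 * x b + 4000 - B.1| ≤ 5) (b2 : |1000 * y b + 4000 - B.2| ≤ 5)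
    (h : adjN A W B = true) : AdjP x y a v b := by
  simp only [adjN, adjZ, Bool.and_eq_true, decide_eq_true_eq] at h
  obtain ⟨h1, h2⟩ := h
  have h1' : (10 * (|(B.1 : ℝ) - A.1| + |(B.2 : ℝ) - A.2|) <
    ((B.1 : ℝ) - A.1) * (W.1 - A.1) + (B.2 - A.2) * (W.2 - A.2)) := by exact_mod_cast h1
  have h2' : (10 * (|(B.1 : ℝ) - A.1| + |(B.2 : ℝ) - A.2|) <
    ((B.1 : ℝ) - A.1) * (B.1 - W.1) + (B.2 - A.2) * (B.2 - W.2)) := by exact_mod_cast h2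
  rw [abs_le] at a1 a2 v1 v2 b1 b2
  refine ⟨(B.1 : ℝ) - A.1, (B.2 : ℝ) - A.2, ?_, ?_⟩
  · have p := mul_err ((B.1 : ℝ) - A.1) (1000 * x v - 1000 * x a) (W.1 - A.1)
      (abs_le.2 ⟨by linarith, by linarith⟩)
    have q := mul_err ((B.2 : ℝ) - A.2) (1000 * y v - 1000 * y a) (W.2 - A.2)
      (abs_le.2 ⟨by linarith, by linarith⟩)
    linarith
  · have p := mul_err ((B.1 : ℝ) - A.1) (1000 * x b - 1000 * x v) (B.1 - W.1)
      (abs_le.2 ⟨by linarith, by linarith⟩)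
    have q := mul_err ((B.2 : ℝ) - A.2) (1000 * y b - 1000 * y v) (B.2 - W.2)
      (abs_le.2 ⟨by linarith, by linarith⟩)
    linarith

theorem eqF_eq {a b : Fin 52} (h : eqF a b = true) : a = b :=
  Fin.ext (Nat.eq_of_beq_eq_true h)

theorem seg_coord (P : Fin 52 → EuclideanSpace ℝ (Fin 2)) (a b : Fin 52)
    (z : EuclideanSpace ℝ (Fin 2)) (hz : z ∈ segment ℝ (P a) (P b)) :
    ∃ t : ℝ, 0 ≤ t ∧ t ≤ 1 ∧ z = P a + t • (P b - P a) ∧ ∀ i, z i = P a i + t * (P b i - P a i) := by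
  rw [segment_eq_image'] at hz
  obtain ⟨t, ht, rfl⟩ := hz
  exact ⟨t, ht.1, ht.2, rfl, fun i => by simp⟩

theorem sep_seg (P : Fin 52 → EuclideanSpace ℝ (Fin 2)) (a b c d : Fin 52)
    (h : SepP (fun v => P v 0) (fun v => P v 1) a b c d) (z : EuclideanSpace ℝ (Fin 2))
    (h1 : z ∈ segment ℝ (P a) (P b)) (h2 : z ∈ segment ℝ (P c) (P d)) : False := by
  obtain ⟨l, m, g1, g2, g3, g4⟩ := h
  obtain ⟨t, t0, t1, -, ht⟩ := seg_coord P a b z h1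
  obtain ⟨u, u0, u1, -, hu⟩ := seg_coord P c d z h2
  have k0 : l * z 0 + m * z 1 = (1 - t) * (l * P a 0 + m * P a 1) + t * (l * P b 0 + m * P b 1) := by
    rw [ht 0, ht 1]; ring
  have k1 : l * z 0 + m * z 1 = (1 - u) * (l * P c 0 + m * P c 1) + u * (l * P d 0 + m * P d 1) := by
    rw [hu 0, hu 1]; ring
  generalize l * P a 0 + m * P a 1 = A at *
  generalize l * P b 0 + m * P b 1 = B at *
  generalize l * P c 0 + m * P c 1 = C at *
  generalize l * P d 0 + m * P d 1 = D at *
  generalize l * z 0 + m * z 1 = Z at *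
  have q1 : Z ≤ max A B := by
    have := mul_le_mul_of_nonneg_left (le_max_left A B) (sub_nonneg.2 t1)
    have := mul_le_mul_of_nonneg_left (le_max_right A B) t0
    linarith
  have q2 : min C D ≤ Z := by
    have := mul_le_mul_of_nonneg_left (min_le_left C D) (sub_nonneg.2 u1)
    have := mul_le_mul_of_nonneg_left (min_le_right C D) u0
    linarith
  have q3 : max A B < min C D := by
    rw [max_lt_iff, lt_min_iff, lt_min_iff]; exact ⟨⟨g1, g2⟩, g3, g4⟩
  linarith

theorem adj_seg (P : Fin 52 → EuclideanSpace ℝ (Fin 2)) (a v b : Fin 52)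
    (h : AdjP (fun v => P v 0) (fun v => P v 1) a v b) (z : EuclideanSpace ℝ (Fin 2))
    (h1 : z ∈ segment ℝ (P v) (P a)) (h2 : z ∈ segment ℝ (P v) (P b)) : z = P v := by
  obtain ⟨l, m, g1, g2⟩ := h
  obtain ⟨t, t0, t1, hz, ht⟩ := seg_coord P v a z h1
  obtain ⟨u, u0, u1, -, hu⟩ := seg_coord P v b z h2
  have k : t * ((l * P v 0 + m * P v 1) - (l * P a 0 + m * P a 1)) +
      u * ((l * P b 0 + m * P b 1) - (l * P v 0 + m * P v 1)) = 0 := by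
    have e0 := ht 0
    have e1 := ht 1
    rw [hu 0] at e0
    rw [hu 1] at e1
    linear_combination l * e0 + m * e1
  have p1 := mul_nonneg u0 (sub_pos.2 g2).le
  have p2 : t = 0 := by
    by_contra hne
    have : 0 < t := lt_of_le_of_ne t0 (Ne.symm hne)
    have := mul_pos this (sub_pos.2 g1)
    simp only at this p1
    linarith
  rw [hz, p2]; simp

theorem mem_EE {e : Fin 52 × Fin 52} (h : e ∈ EE) : ∃ w ∈ rows, w.1 = e := by
  simpa only [EE, List.mem_toFinset, List.mem_map] using h

theorem main_aux : ∃ P : Fin 52 → EuclideanSpace ℝ (Fin 2),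
    (∀ v, |1000 * P v 0 + 4000 - XA v| ≤ 5) ∧ (∀ v, |1000 * P v 1 + 4000 - YA v| ≤ 5) ∧
    ∀ e ∈ EE, e ∉ bad → dist (P e.1) (P e.2) = 1 := by
  obtain ⟨qx, qy, bx, by', z1, z2, z3, z4, hq⟩ := quarter
  let x : Fin 52 → ℝ := fun v => if v = 48 then qx 9 + 15 / 17 else sgn (fx v) * qx (idx v)
  let y : Fin 52 → ℝ := fun v => if v = 48 then qy 9 + 8 / 17 else sgn (fy v) * qy (idx v)
  refine ⟨fun v => !₂[x v, y v], ?_, ?_, ?_⟩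
  · intro v
    have e : (!₂[x v, y v] : EuclideanSpace ℝ (Fin 2)) 0 = x v := rfl
    simp only [x, XA]
    by_cases hv : v = 48
    · have := bx 9
      have e9 : AX 9 = -903 := rfl
      rw [abs_le, e9] at this
      rw [abs_le]
      simp only [hv, if_true]
      push_cast at this ⊢
      constructor <;> linarith
    · have := bx (idx v)
      rw [abs_le] at this ⊢
      simp only [if_neg hv]
      cases fx v <;> simp [sgn] <;> constructor <;> linarith
  · intro v
    have e : (!₂[x v, y v] : EuclideanSpace ℝ (Fin 2)) 1 = y v := rfl
    simp only [y, YA]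
    by_cases hv : v = 48
    · have := by' 9
      have e9 : AY 9 = 3191 := rfl
      rw [abs_le, e9] at this
      rw [abs_le]
      simp only [hv, if_true]
      push_cast at this ⊢
      constructor <;> linarith
    · have := by' (idx v)
      rw [abs_le] at this ⊢
      simp only [if_neg hv]
      cases fy v <;> simp [sgn] <;> constructor <;> linarith
  · have key : ∀ i a b, enc i a b ≠ 48 → x (enc i a b) = sgn a * qx i ∧ y (enc i a b) = sgn b * qy i := by
      intro i a b hne
      obtain ⟨h1, h2, h3⟩ := enc_ok i a b
      simp only [x, y, if_neg hne, h1]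
      constructor
      · rcases h2 with h | h | h
        · rw [h]
        · rw [h, z3]; simp
        · rw [h, z4]; simp
      · rcases h3 with h | h | h
        · rw [h]
        · rw [h, z1]; simp
        · rw [h, z2]; simp
    have hd : ∀ a b : Fin 52, (x a - x b) ^ 2 + (y a - y b) ^ 2 = 1 →
        dist (!₂[x a, y a] : EuclideanSpace ℝ (Fin 2)) !₂[x b, y b] = 1 := by
      intro a b h
      rw [EuclideanSpace.dist_eq, Real.sqrt_eq_one, Fin.sum_univ_two]
      simpa [Real.dist_eq, sq_abs] using h
    intro e he hb
    obtain ⟨w, hw, rfl⟩ := mem_EE he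
    apply hd
    rcases EE_unit w hw with (h | h) | ⟨z, hz, s, -, n1, n2, h⟩
    · exact absurd h hb
    · have f1 : fx 36 = false := by decide
      have f2 : fy 36 = false := by decide
      have f3 : idx 36 = 9 := by decide
      have f4 : (36 : Fin 52) ≠ 48 := by decide
      rw [h]
      simp only [x, y, if_neg f4, if_true, f1, f2, f3, sgn]
      simp
      norm_num
    · have k1 := key _ _ _ n1
      have k2 := key _ _ _ n2
      have := hq z hz
      rcases h with h | h <;> rw [h] <;> simp only [k1, k2] <;>
      linear_combination (qx z.1 - qx z.2) ^ 2 * sgn_sq s.1 + (qy z.1 - qy z.2) ^ 2 * sgn_sq s.2 + this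


theorem bad_vals : (XA 48 = 3980 ∧ YA 48 = 7661) ∧ (XA 38 = 4903 ∧ YA 38 = 7191) ∧
    (XA 40 = 3922 ∧ YA 40 = 6625) ∧ (XA 42 = 4078 ∧ YA 42 = 6625) := by decide +kernel

theorem bad_dist (P : Fin 52 → EuclideanSpace ℝ (Fin 2))
    (hx : ∀ v, |1000 * P v 0 + 4000 - XA v| ≤ 5) (hy : ∀ v, |1000 * P v 1 + 4000 - YA v| ≤ 5) :
    ∀ e ∈ bad, 1 < dist (P e.1) (P e.2) ∧ dist (P e.1) (P e.2) < 1.1 := by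
  obtain ⟨⟨a1, a2⟩, ⟨b1, b2⟩, ⟨c1, c2⟩, d1, d2⟩ := bad_vals
  have key : ∀ v : Fin 52, (1 < (P v 0 - P 48 0) ^ 2 + (P v 1 - P 48 1) ^ 2 ∧
      (P v 0 - P 48 0) ^ 2 + (P v 1 - P 48 1) ^ 2 < 1.1 ^ 2) →
      1 < dist (P v) (P 48) ∧ dist (P v) (P 48) < 1.1 := by
    intro v ⟨h1, h2⟩
    rw [EuclideanSpace.dist_eq, Fin.sum_univ_two, Real.dist_eq, Real.dist_eq, sq_abs, sq_abs]
    constructor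
    · rw [Real.lt_sqrt (by norm_num)]; linarith
    · rw [Real.sqrt_lt' (by norm_num)]; exact h2
  have x0 := hx 48
  have y0 := hy 48
  have x1 := hx 38
  have y1 := hy 38
  have x2 := hx 40
  have y2 := hy 40
  have x3 := hx 42
  have y3 := hy 42
  simp only [a1, a2, b1, b2, c1, c2, d1, d2, abs_le] at x0 y0 x1 y1 x2 y2 x3 y3
  push_cast at x0 y0 x1 y1 x2 y2 x3 y3
  have sq : ∀ u lo hi : ℝ, 0 ≤ lo → lo ≤ u → u ≤ hi → lo ^ 2 ≤ u ^ 2 ∧ u ^ 2 ≤ hi ^ 2 := by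
    intro u lo hi h0 h1 h2
    constructor <;> nlinarith
  intro e he
  simp only [bad, List.mem_cons, List.not_mem_nil, or_false] at he
  rcases he with rfl | rfl | rfl
  · refine key 38 ?_
    have p := sq (P 38 0 - P 48 0) 0.913 0.933 (by norm_num) (by linarith) (by linarith)
    have q := sq (P 48 1 - P 38 1) 0.46 0.48 (by norm_num) (by linarith) (by linarith)
    have r : (P 38 1 - P 48 1) ^ 2 = (P 48 1 - P 38 1) ^ 2 := by ring
    rw [r]
    norm_num at p q ⊢
    constructor <;> linarith
  · refine key 40 ?_
    have p := sq (P 48 0 - P 40 0) 0.048 0.068 (by norm_num) (by linarith) (by linarith)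
    have q := sq (P 48 1 - P 40 1) 1.026 1.046 (by norm_num) (by linarith) (by linarith)
    have r : (P 40 1 - P 48 1) ^ 2 = (P 48 1 - P 40 1) ^ 2 := by ring
    have r' : (P 40 0 - P 48 0) ^ 2 = (P 48 0 - P 40 0) ^ 2 := by ring
    rw [r, r']
    norm_num at p q ⊢
    constructor <;> linarith
  · refine key 42 ?_
    have p := sq (P 42 0 - P 48 0) 0.088 0.108 (by norm_num) (by linarith) (by linarith)
    have q := sq (P 48 1 - P 42 1) 1.026 1.046 (by norm_num) (by linarith) (by linarith)
    have r : (P 42 1 - P 48 1) ^ 2 = (P 48 1 - P 42 1) ^ 2 := by ring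
    rw [r]
    norm_num at p q ⊢
    constructor <;> linarith

theorem planar (P : Fin 52 → EuclideanSpace ℝ (Fin 2))
    (hx : ∀ v, |1000 * P v 0 + 4000 - XA v| ≤ 5) (hy : ∀ v, |1000 * P v 1 + 4000 - YA v| ≤ 5) :
    ∀ e ∈ EE, ∀ f ∈ EE, e ≠ f →
        ∀ x ∈ segment ℝ (P e.1) (P e.2) ∩ segment ℝ (P f.1) (P f.2),
          (x = P e.1 ∨ x = P e.2) ∧ (x = P f.1 ∨ x = P f.2) := by
  intro e he f hf hne z hz
  obtain ⟨w, hw, rfl⟩ := mem_EE he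
  obtain ⟨u, hu, rfl⟩ := mem_EE hf
  have hc := chk_all
  rw [List.all_eq_true] at hc
  have hc := hc w hw
  rw [List.all_eq_true] at hc
  have hc := hc u hu
  have app : ∀ r ∈ rows, (|1000 * P r.1.1 0 + 4000 - r.2.1.1| ≤ 5 ∧ |1000 * P r.1.1 1 + 4000 - r.2.1.2| ≤ 5) ∧
      (|1000 * P r.1.2 0 + 4000 - r.2.2.1| ≤ 5 ∧ |1000 * P r.1.2 1 + 4000 - r.2.2.2| ≤ 5) ∧
      r.2.1.2 ≤ 10000 ∧ r.2.2.2 ≤ 10000 := by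
    intro r hr
    obtain ⟨⟨h1, h2⟩, ⟨h3, h4⟩, h5⟩ := rows_ok r hr
    have k1 := hx r.1.1
    have k2 := hy r.1.1
    have k3 := hx r.1.2
    have k4 := hy r.1.2
    rw [← h1] at k1
    rw [← h2] at k2
    rw [← h3] at k3
    rw [← h4] at k4
    simp only [Int.cast_natCast] at k1 k2 k3 k4
    exact ⟨⟨k1, k2⟩, ⟨k3, k4⟩, h5⟩
  obtain ⟨⟨w1, w2⟩, ⟨w3, w4⟩, w5, w6⟩ := app w hw
  obtain ⟨⟨u1, u2⟩, ⟨u3, u4⟩, u5, u6⟩ := app u hu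
  simp only [chk, same, adjB, Bool.or_eq_true, Bool.and_eq_true] at hc
  obtain ⟨hz1, hz2⟩ := hz
  rcases hc with h | h | ⟨h1, h2⟩ | ⟨h0, h⟩ | ⟨h0, h⟩ | ⟨h0, h⟩ | ⟨h0, h⟩
  · exact (sep_seg P _ _ _ _ (sep_sound (fun v => P v 0) (fun v => P v 1) w u w1 w2 w3 w4 u1 u2 u3 u4
      w5 w6 u5 u6 h) z hz1 hz2).elim
  · exact (sep_seg P _ _ _ _ (sep_sound (fun v => P v 0) (fun v => P v 1) u w u1 u2 u3 u4 w1 w2 w3 w4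
      u5 u6 w5 w6 h) z hz2 hz1).elim
  · exact absurd (Prod.ext (eqF_eq h1) (eqF_eq h2)) hne
  · have h0 := eqF_eq h0
    have := adj_seg P _ _ _ (adj_sound (fun v => P v 0) (fun v => P v 1) _ _ _ _ _ _ w3 w4 w1 w2 u3 u4 h)
      z hz1 (by rw [h0]; exact hz2)
    exact ⟨Or.inl this, Or.inl (by rw [this, h0])⟩
  · have h0 := eqF_eq h0
    have := adj_seg P _ _ _ (adj_sound (fun v => P v 0) (fun v => P v 1) _ _ _ _ _ _ w3 w4 w1 w2 u1 u2 h)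
      z hz1 (by rw [h0, segment_symm]; exact hz2)
    exact ⟨Or.inl this, Or.inr (by rw [this, h0])⟩
  · have h0 := eqF_eq h0
    have := adj_seg P _ _ _ (adj_sound (fun v => P v 0) (fun v => P v 1) _ _ _ _ _ _ w1 w2 w3 w4 u3 u4 h)
      z (by rw [segment_symm]; exact hz1) (by rw [h0]; exact hz2)
    exact ⟨Or.inr this, Or.inl (by rw [this, h0])⟩
  · have h0 := eqF_eq h0
    have := adj_seg P _ _ _ (adj_sound (fun v => P v 0) (fun v => P v 1) _ _ _ _ _ _ w1 w2 w3 w4 u1 u2 h)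
      z (by rw [segment_symm]; exact hz1) (by rw [h0, segment_symm]; exact hz2)
    exact ⟨Or.inr this, Or.inr (by rw [this, h0])⟩

theorem inj (P : Fin 52 → EuclideanSpace ℝ (Fin 2))
    (hx : ∀ v, |1000 * P v 0 + 4000 - XA v| ≤ 5) (hy : ∀ v, |1000 * P v 1 + 4000 - YA v| ≤ 5) :
    Function.Injective P := by
  intro v w h
  by_contra hne
  have h1 := hx v
  have h2 := hy v
  have h3 := hx w
  have h4 := hy w
  rw [h] at h1 h2
  rw [abs_le] at h1 h2 h3 h4
  rcases XY_inj v w hne with (k | k) | (k | k)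
  · have : (XA v : ℝ) + 10 < XA w := by exact_mod_cast k
    linarith
  · have : (XA w : ℝ) + 10 < XA v := by exact_mod_cast k
    linarith
  · have : (YA v : ℝ) + 10 < YA w := by exact_mod_cast k
    linarith
  · have : (YA w : ℝ) + 10 < YA v := by exact_mod_cast k
    linarith
end NM

open scoped Classical

theorem near_matchstick_52 :
    ∃ (P : Fin 52 → EuclideanSpace ℝ (Fin 2)) (E : Finset (Fin 52 × Fin 52)),
      Function.Injective P ∧
      (∀ e ∈ E, e.1 < e.2) ∧
      E.card = 104 ∧
      (∀ v : Fin 52, (E.filter (fun e => e.1 = v ∨ e.2 = v)).card = 4) ∧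
      (∀ e ∈ E, ∀ f ∈ E, e ≠ f →
        ∀ x ∈ segment ℝ (P e.1) (P e.2) ∩ segment ℝ (P f.1) (P f.2),
          (x = P e.1 ∨ x = P e.2) ∧ (x = P f.1 ∨ x = P f.2)) ∧
      (E.filter (fun e => dist (P e.1) (P e.2) = 1)).card = 101 ∧
      (∀ e ∈ E, dist (P e.1) (P e.2) = 1 ∨ |dist (P e.1) (P e.2) - 1| < 0.1) := by
  obtain ⟨P, hx, hy, hu⟩ := NM.main_aux
  have hb := NM.bad_dist P hx hy
  refine ⟨P, NM.EE, NM.inj P hx hy, ?_, NM.EE_card, ?_, NM.planar P hx hy, ?_, ?_⟩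
  · intro e he
    obtain ⟨w, hw, rfl⟩ := NM.mem_EE he
    exact NM.EE_lt w hw
  · intro v
    convert NM.EE_deg v
  · rw [← NM.EE_bad]
    refine congrArg Finset.card ?_
    apply Finset.filter_congr
    intro e he
    constructor
    · intro h h'
      exact absurd h (hb e h').1.ne'
    · exact hu e he
  · intro e he
    by_cases h : e ∈ NM.bad
    · right
      have := hb e h
      rw [abs_lt]
      constructor <;> norm_num at this ⊢ <;> linarith
    · exact Or.inl (hu e he h)
end

section
/- There exist 53 distinct points in ℝ² and a set E of 106 unordered pairs of these points such that every point is an endpoint of exactly 4 pairs in E, the closed segments of any two distinct pairs intersect at most in a common endpoint, exactly 103 of the pairs join points at distance exactly 1, and each of the remaining 3 pairs joins points at a distance d with |d − 1| < 0.02. -/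
open scoped Classical

def nmCX : ℕ := 4234967246260028079560510224799125176039179259496419767622684363306616515872170061881111760892121097219248971968295767328592901676804040326494030105614950341132265433812083813740825276693486162597094945041387041237419102321902701722818265857824175046985405562896694947558142449016760043415488344993810335400534086751136300701482672414748657928164089449321806923184109998407259756433598700544889366609491731562091959537591907592095148625104150752763434590229459906802661615472029573932760325317105014065547850284568032400244387302016743539249817598006500192758276013043554879985934499

def nmCY : ℕ := 4989579585128133408225237860900893375882722840095535456304874178373969695390748906489976409270613603171752529122507989221181606710852803867717148708961754395471361003038531044640012667928337436501712377850156018073528560223337041713149552982540657355479718453302467636708152166514247706598636771996925136403660093476650509355892635899301307868150900465773087878528183053912772027914027513055238706043721164969601071590600311689446640616336776379226884820009775457764966468768485804745593219448044362677809313813352949499805492764981918113356546366358863522904025007541641750136597429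

def nmEU : ℕ := 27041607362603444343424942415041064907480701474645010044004342410634333235323131303004053837360535073406330632313004222121202720192819020326052524230522042120190212111013100909080800011514010313031202110210090800

def nmEV : ℕ := 28231752525252464647475151515150505049494848484746454545444443424140404040373738383939393938373636353534343333323130242425252929292928282727262625242323222221201918181818151516161717171615141414131312121111100908

def nmAX : List ℕ := [
  58366448333205634313735240601350779738140671175647223043426911921489998263178318091907345280801151043490128277423626960735425942778981793595171916721556616794039849655235170924101545924239654357717657102334045716954002804947281282470389579056910889820559316266110855993481551830771355042049943877725043596009691093146555736703778552369341579,
  58480390699436720816271218842324839098246745257317139115039515414046991801334622522423219263921628820561634450381933022982715087583930773160501510138495917782629076839720471044144046837659290287041661236799037331834148952657394795780137152814063816366270608968772634185055582072092408062299171614788526137538772287479707457443973243687095431,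
  58081982018438129923279648280556570765436491391152683699441277290338739153602965078509877963836952009379649921798953261630421262308432222047126909639794431403841334952403037699073720389832221081000332612804246279105164134558090513754959377322878597235590625355537406870651480753559085911044939609179827824749862153744121860425498339850509289,
  55637118857011790894740963396651331728093412320673869551849466407978179586923551429613801583073286226318717408403901715915811196021606790432856001920639335761005887699767562777712578335195845183709407144818984250848989156040319449439292449719088573362369014177320806229086891430041687660512953549142897759398935213359201901971715938880275426,
  59794512715059765019937260670094246422629850724913802660324960471988056638478188952096744010381869299938744872378341604457281909716446499975329602221645388280813243010761099688422227355740256449028136707945843783130084853850745626507716769949521360888775340824629946116076210888202606106951728106044175554344019898463613373007223513275110378,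
  59908343755130116867454996864814969021810786318289082785002742081390017516275894993297293755343101937043497868143723865106591432729219007024358015574666623546663041958328472219709315280331215382125669137902223269847109903016997726497299557762466465359392335952359923625894049640024503959239110773170384034781097883059959328160846503548488681,
  58708776345250213838146126812153825137516333058789280689504767323043417690021986291502100316703561325778443704307702870753383429533128352487237520856390107080212144227793871346979232100812263508654478962325691382142859930340748343355478062875827069060876764314655452722112076005099162795280972011300038872653535037189003636971107929900942318,
  61157785998470937377271570609501484300358236081396277749397689830179021293449766468726029536091507284127437833366233225923819880003334274682409634168667778826873058362911682635233044803027890554403519212850445761081520246536135915574103587654870056853917336538427950730410038897652777644278300802171707756386124320701505651797754850417019884,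
  58708108483400162326875977589747920198292188792890671170539060413781207529824527195829388891234845220432079977097433182552725201802869304943627664332054275875204328495138200686537599468058965032037868490045027908233751298353786246872397185103629435918677765472280581597829317614075529105146243526180222780884402461893091820774571804893371431,
  58139259307733455973242386159723465578534782044275977189775272697316794797748570070313571720618162249827560279497438954566035605540347175796983048847116613204282697970322319196802091919560505200037959296791899526222226525532703977316862175837877250898948870893763761818066902323108681912245272299373808850217300188872217114601077190120557577,
  57513466780484761759944033194154798151430717332474885530655405135234674352939602469865618722153835162925489538713777457020502827790158948784745831432747553395452355738373668219037337377980742232915305533435660200371542239609448968121409548055840098271418069635884010508291235423849623297812388503016425557437584020412920213686794576956701674,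
  57797710483693017349080821495824483633104214921469742406690903642119702796597304848145347989189831111575563259948561011979924315116136965844769595405936027405967428525794907995436658552545780694558779223904815626296840443158323726931564689500233708334538790019631501322805695981150800261596630937413846811653834442680202770810204327675628522,
  57399691389905148304200595562946618675001429510279209229551151360718809961709057097584896790853191239821421389751796733067288941157198007498032734832445330801295976886270445804667711089464952475879562027919206176157072689675834483909987101813776048861194347738397387739081396061812218473483736244643713175066646064112846045699138937893637099,
  56774371944491008288249754739230652927087817881289615133890625798314346639396359829963381495186286965027135312876267651707822059209985105586357090884339032389908094903332523600509393296970171716621409442958266633577529854211029281471091831578565500945233862751313725245398946360948103515192248453112409200384015249394341332751493216000259052,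
  56035137964382654942263758270928610553221146215953325706678921721452233472340220575978523124498324576034434692431388066760820736912804619737739756662471738582046422513164947519324779298249090301980704972659226229448580412637306829515139010806293987712451631914762588099929883688100824729626493209873244452049687057913007995355097921874783205,
  58025428254073476806047251652540788125973867760330434163767352992136418132934425930350303231307745533325909133771265784427516643455125710427646992160350840861213461526611329931152142271921928856782215143410759007422055517595046202176699433917486957595274191567546106454055907454624433178115317494370769366006775591080031309155099396995644421,
  58651220794905153071404182297235323933173704552540428100038356833478990819956398777601330234283530156001365417617755283881271279639369389285233688313473761666903297225902638919170089341014264556312948088511132378229795612196690255477894057271670363762661841759495909311398817421330598980876921105144346799552250989892374517479397004123837476,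
  58423391698363984857425705392057652994406339168897089390415915626042540419384446196547282976073431685277940445770154343949561215731966899655390068045304417283341917598448245357857379307285740791295046199611026694448840963123592262437548256693990369230849018267944407863777704539719879007148240704759542496286819138434601633933508864500790413,
  57115419868743017782059574354018152230225255410352561026462317619567249629908974199807255509049292868211087967816666570468926770267494840955763823406135009772514713374107175970544833572345322778363014821546628992043270033192554458400607269064217838219564446336772436380295392967089563450191313233787587417320715775016585908936076046389703659,
  57226189751955163044439728235394373613805810419303834941631945587599056827876548771799071270727087336735785947515485792127333205968451445895351621743464965266683543388547851615676649264407368519443031553788452938769699346049582314843576523697780417320755302881691506473759585618658012673744276640930429125040651375341901223236793433604418538,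
  56370397471889210876687989027740788733179585671310204661523374121633654236683415323210612890577153819686120465138945666972317389087441674934452549804751816205709565434922598038263693947851461818580477125991741873805680817219117553061457030952992943224789941546044348123291807963432811172596363792511853556780448652338615025988581007785130988,
  57625850757111073773245752864712915721237913859314879143664049677746998018141554163084838968114978601750566172134012730121852760677346095349690259010730298821794987059790220933849671239284057190532824464992940197999457017429575739072708557664572384579793402931015163959207947214541268969462509317383725399523228191182796610688625701528992747,
  58938303016246318180419126805322946420066811889553644383543982569180961861586833457838767853865091133656626824859043614063247402131287546082203123409253315784992955643858406710392671895033006258075444493371190837760459316787289782396079945887918860019139141736827338845984145632800045899774189044720993249902012441761946775679383855196734441,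
  60079591269352621086426729509583512384352212223988752628177020950029644561939979134093073191153401710909808417237578670172697561062504794793977569138690402936713558796415287439721164741769580826126392996826424903854359732191285854451161959627373070668736432409454079731375632337431316248552734226992823305553998635876965660427087765468810216,
  58767139010217376679253355192153990146255672759126781519129826209335573896615435249689948371903159305764697513130253600387156393525057281261157559489301444587895603191368102036455964579609895063940405827421522323928573706857933120223410099250670102573517542371228086084712626759497537035657637313711456573651795158256251814001447500620170218,
  57511657907041638851273398155024610360413718766458770683046695707346454422374647919009660858547520381662206067464228209201496097839631721846074855233058547229018708354588644760695222332232686072268144007953554593267286877059829195361403216809552513431716523816903338010491848799580430821277161056222332677099435218789561930933985548764642283,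
  52090295195789725456311669200230986417047396359198241967165967022277652258177705844673469069508889600468571237291788938068539395240325865939994081799338307723797927342096664242265115195788036648511523418725916479865122779096440707038578441454628890738813247079981656542446647103186259704050101473049108297211617585227321613477898549305762805,
  54144736499291453352519078591825858337986047016840095930562422591750712339469741178889223358224054955847105879679685267574592462554725498563087054936263630417475486358276059413658868543865232997532553597984983662749164126890162638207513769848646982787863287735008592032848708983957688602102230232661923741819760785331251078828746676507718641,
  56142234464794181917990865754113503933111966418523744086779798550173151819367919824393768479370896496727078743735294427554427760742729851701923439490626676307289862020230665294298902195604938083237559996811941077282573446727757590988201540025176848336525621918528208124091055358549081573612872132889653408840048150039991032185656454374423532,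
  55286442198311215039150945708951396710027010648868550425049651163214436614515687742329616362999129586990257812438372892356613956016929016248597281113682664324203507306194824559182642229952210467041049730105333696587072398278357634657338249731147047826698841609700198352623213361280069828688325043045888666577993411078117456309181803344628717,
  59736372702400735640810507904892456356529591205022207798981633937236280968849729213345609831614759756899451242385047965792050980783330273930831452553011611070118505339134841714576435970092454104603714528718389135843839293911380152145066753214651313862271804139203854880671784937362025550810231563186360432417843169820777622849328416800320489,
  59621261520212475786051134651230026812968647177697936458762397637782366337142378227378574281149983434691438719580481123194195124256861569319421347122056296256480447898855993716198099410002126536098492173893530447130580758943328176489443956656004560028179267806763575970246725215888489786542480219685774306331191191511401959140449802791109608,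
  59506150338017586854273480444484503600375609744514652265825552379925622028640929210718312338798785170004333675945625517777536372170631769683603147908751865685905019867368191260969668295453913583876400176263703452414964257264083282225371314094114721424608125845592612021023650403365086167609482996037204321619448011447475168147526135031227368,
  59107463341637216504727604365327385046737392237775500067365089234787784679351452575504436269579985937610362869757404875965733332548245244845793117168118689287919305799518475710957312084912242479354946493038965990099951757680065911518271352063834814210423510551929525253333346584514339320356439659050559435877726366134030980719870417473336299,
  59677008237863489279262710555848117135749196820705632452541645491020525943562522834998946065349654710857742790551920535474960869121735593756773792269889187730713501191979587605275575031528677413033052132294377302187084897100023238887712192176524801552772490560006646760280084301596201324783225123675536415003824911255107721096157607015439335,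
  60588296765318427125691557312895919934677567847478728524121423455058672867764262617320745996846866603340559531080167279798411620677164767246244338270782253900836546276412167839933840487684532189505848356914994470573134168709101717065721618179027440651989756068089238676265909248582553077260183311666085771551139517737242628043488726236478432,
  61385336806782918791667740448736452952559905540440456742906499996019858178395465897747587330810504608206043857100541727713516055147956104311437407049580569079607767267347041766109551610469188814559071369058863510378892034693149956402764735704745409521794010420655659826674146997756221603726693490029877946349216326554621978687486217880019930,
  59621122362514913280834181571681227450237807711921626053381718528016869019184478286276192797015207799137953236956895210430992326849458764319156715077080183059018007090697301916501602271503188061828150471699661475271256605681976512279072333337968237065416703807304126794449566880641625833586075400902430214903506504984377736796563243911826408,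
  59679262375173942661542201940846291837538763840118145364758116836528449898522336808013493858428796978497165258841445961206705453897890738116944215538762785649919178902186866359261141030840460639766995501468406193378664823611748157699194537294821911647485779619386387579300555623689664406566208571336544834617800775788844466824087625980128233,
  59794373557362199276284254673575463535316720635558336604756381366636241031758541641041730814523239171148556355696094742305371716706392811731478143885683178103080396879921733270458877930370446909775916068076653966706278200150996275088379903690335750723569449455679605368737868000632115764724260817408702879553728143538043350426851020187309033,
  60075695220667506655350329993251738121544133811529856800245860295764723678081751027806209088129327666352289785546853213135504905264059013366640261899127030483621028959567594434273878687718670821454086687711283981579848829416672041860659423840036589116210332925877935644182593882066385125986790116808429060604719222749283882055875523845770212,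
  58993520975406146188051464221545471447722186126988268054422206927429909244143514177878902096389931609814035144863844150810131412230878785889939629786609840140423294666253385545088277545441664210013317920977511486678852195232788632913394450417142167045564193522884195278553390854409342269959417548315376210764029761471483697902503080333644784,
  59278293423522589023269382372130062106867666149534831114798181490836137019513336396152596298893772104267938945349112584360502171236451754357730132640194399553890291621269843593263224277730292171798607533993251122662040433752823198029296120170367714299154589283028340264483600978390508973023564007027840698732320912509290852467366624875226099,
  58993326181800691396870061851718932287379486207595769134464089602085188876331612080172457028107736967190431488002497418537268401647012708393217938452251127602859471617154833914473263716626455012312974381303474130494512307294846895429784254092731705854798865205298065404686632842435741637476235195233401832282303627154418526164911380051846181,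
  58708386744456759177436083095772792765780681163272072138128167240788622069414712227296455394238283576570927946205628150415171427543755082635504832139453637405969752627443768613147271965287774965994887962481623372300708252984397881591053924506611367250522997724883231873517402820312571615139990510415355918513335381394643874141026765477389400,
  58423447347861358801510665084357798449221729036197592829910985738670202500616163160211929851530907500023687908442688461008278231595872024964561434871604006295523227457158724642050033301359068752756763411969658471733718680376443944052662302525893188798987179492540142255720036682428893470338163081729777784027874609251625417301306290844417156,
  58708386771622305515398391208512891687680130238602337244601185020009043593736449943686860381965651263998911447992264867231413892558636328377630068031887915333126479447685295724112239335226135292864923463643134738101072657867253721728422142507557141714357294161126262947954770921986014486331773277760182930880884921521560560055957761265106001,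
  59050325182873427355610569250160426236923238128019781743416710719949273155017767645932972500896206848866497289963342876785818836460317660504352200824180558769220657076262517547537590680563368353123793212107051632092461172624216565997666297041517102648697476179184843184590371768451223511842374453070902932478792798688714926320201196787252255,
  60759099002083928236978981613940122740998328865988490298492807129999490903808432992306990742875905967201378947898989197908470046653488090833231815824786785910263211446625562639372688128231433111412534829405489262472843940962470013425738804723133544952656024089375295299376229055351788891065818388575239434318388692637139276313316803011912689,
  60075611739633220698078396780090403489709053761849338946505634995199003989821033237204767245340150090483423588952159668117990617511033117946436794059019383469194843371985629804087822820335791162406821619491551258317631086874498781254261527809436673622583820007235721355776710390086250161319546916304683611274879612061020318556960389337175033,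
  59392180140256272448439114309695253772602501763848917826268944669707399105680203181697105159335199054175611433304467496406712787034113391289461218243399923415892500447671582899829891345935368840698424788854178438155033951397408763541987239214449981043583198260965060387730500427656294365231963964220110390407658632697238683828821802855934963,
  59676952574783094437690747096188599165224056614664815398172803510696790923193164240647189525663227586378828236021499432027226355927071872824860748677760742188232850273303651941163110994087482567593948133060063837057774883585302503157802012802687639887015649057248993573937249929402179866814056786049338937171103095923660943637874292612381686,
  53582651174291458135221795948107064588010370792843683602718357931129650388165752561589269774055610998848275217985813164129170152935304837409661411347108254148218633852781869350549445149334906917687342630861219738430599836005788377371902657509053593725541335535812917804381323884580667794290352024066783989424377956775618686713481255628796902]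

def nmAY : List ℕ := [
  57056667670870648562890817693157997609189041059821069867290641706477755136510147657471129139860311964737400027543484379647529220246209020204240763788943465888765768817800848784464868036945389196817834037735013803559396500136240090290579676119271203533411575261379295940610912232676940627055937749428566556045189601539269226132698376318114751,
  57113332761389400779668262669185202653951949924953240418599064079000743757380504890328230536446915203433173622247839641489887902599143294847346809936100697494448391292038486484135884562864876554316106580217078139563467393729846857972350181250562949680641490938756791697843863987950799672125116850152665099756618481124449474374268291530109962,
  57852483260463519958071981656123095889170216473638498064031620859028738120717978188194378455594652939051314092619091958090128401655804292313703177124156695426967337632978893053689720646460740646819974964900731061150188705417790018440812510554554519614702668499930413794863455919481419439588253270291962757534020319854773969725420929793661955,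
  57966258651043143127543081783776772916491731187789452970078512454516470250688663564148476619132495418364291405993970080971093106496861979604107957171348158708989779235984763433395483481215789235585170874026812316689758230555712836042223814968430779251318793840887620718434440106446648590458301402753628697047283280497022287861516233458336772,
  59791813368193999473751866096068157585778255445444346806363747894097916750557233199037879800017252786969702449333296317985749948013849000140992915488795048975345772137454240023856242702553532305159388917239981629912942345004652417915465984383172886087782178212594073224251688835991079945891973265209152129060162519739406741626335749942008831,
  58935798490145216213667100202325384514272401257209218487419543441369153218692095615973900974965489818640740682625308063292341196222820156861305866872185276206784770190694842722160289888437394841445870761441594502199610753443032331035760362464733957729709812575597758584307728279884750901646072277215365257355612486894229077882536338894363651,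
  57910706726990819399084904874726317608612955883400583267079288381209989343470280944812818638325119437062817798491381706010553630320888709204973712804924235645366931155828406333661800623231526618165434156182281864718205403245876013403004868195142388485837795221664254474096692595854804691409696623729884918182538154172856402971087791391259658,
  57967650092149163467482980447168084505052613723793054449396426890572146866030800912847385670942275306699908790323782189320256063162845089867581568909877525422794860142675368733983406886566186994418280168649538513816037793554371999847937271829932886901857045467028818370853302561992752448005717069197908751179222376458007981140565419865680903,
  57227497752762714898724552645632887058144564209605057530014227031763005963794043855349697906663168829770897540295404527133284223277135948779109659860608357335603870919236811719167131211091188118122857381113601287072745357983885482131176450535857933113991285761139787419626942516731199064635610884900266907569046773113097973608885540471344160,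
  56943031424405618795581604180286100757118309334813821467600419372768064197800256682010802695424712842470344385636910494566533106913793391933173688559952946068644426062733957167146087191162071278782062723738142615939135618077668324986890679506192498399346460965114741630323912580644160813538922164212797690532602533494568686994805952587367442,
  56715536265584385483527154657101101872413008010964732155188069013484179071891385586958207789488036919826470683841130852347704149159594947019601869931254982892621282109125697097148183681269090407926234629170789199631133614649341553857083414114424910851554814976377525264350763561312880975100937356975965670548585643858777950944850012660622341,
  57284023672000890186510664756782722225870719244727270156828687681577205095535955752295325193356691725787144892441520877360097383438092837621415276168867273290665100787342196816052624756699602578088267832779411379185624449759854432978391127422872732887799436506834299869179474347795516328286329870219278956425730395196940621748956340345144324,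
  57852594559458258137257272644772690192433769570803328097760999333836565686343657327985738772495656045301615781583066703918255857285652660225100365174097659819756399176739515156217758161727778689077928962479451342072007689778757273261011958310455586978462272747008629321455620814924887837585459275201661527864110778137917486327190638911562755,
  57795734675334148234860978301625236595948782831239498339001007283499236312423776784812218002822369476540317786684358687635412357767434064963584983750385608914590294359918389467146672246173311855550427377027530600394247137231108909692599323270814078297197484281116007441327347927067143477161081040164807684025545909526483928278792298702056451,
  56885893265641910567852777984686331773454012598072762562162700527878794821122749573995578996078947753113329774555165156737082591471739778153589788704675702325334660255248225393835806920037449747234615444976790451125029587427220293836638769798262993611457514677142331838164935645832532027224988365784566354913094027074842948078910782981528571,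
  56317294546660921134419183231444520224802001772101711017688095979682004844336736701312035522897195933858225012248955100222367040573563522005339370268610433759614876538029344161606452469111140410907437375255705025343739379106336148080821681099700400826883111193984509798964862623541605764380741229902026136317416517238870370584870127532981233,
  56544789705475525367873311717257238138022583029914541856008340778134439654909916988884611502757336182968969507717634969468895881147274428516235477764044361483616760367287197690386097423643187255164484255017127145436545654721465031849306892568281589321225051999846439968154099525473179417604912702022084304595739732228064767745327979827321855,
  57455271172640535352354510562269076181017649351652649564503536034701496041931197338913278305193355524416342320801067928957761573560824159136243516817522849103485037195233986105833940793304021559103708481953668149094986528887530280130539286639925085163534335500450241165580116972867620038631571084066675744737422194257048071811197963041954771,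
  57227135983505890643186035706251530115194774496753744897666644996813305917871355407652959320089698060169138395411046165541963986278443591035206817273763201240746436253546360892929945108840423537890861410675309372446235202261103548455411966124921167620629547330863193107271267355179739384243895051713616617901458370725962532024540772343778308,
  59564067766263486373198613848229255295389571488480231017093018256454700214405634998988306841648942891745096016216257994476237419862342900003881720496657438272022846039095090049017280072460892111849556768619050514462648769018558340608885776492247336478583425319095735618808020166659155263161724132737420431282229373142951749489458921139602432,
  61275624467692559908961630142116371190633629046541363539286784872363075845751961061069433747920236298149191815892504453099107349005077716899918616530185088628686489838603907372214504950011929684577582822986528028809400280203575381275828142022459404786782299594399314054681149072276741496806609945721248542473629393933412196934891137868489726,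
  60704966432165787147974285742100532213299105747128325342022822607647424730864365782905384001534579194146052160605206645883519445400859274069177512791115030160204382445076045305262066652184593616888017375223416723377018831611504472183408247520719636890028889693668578372245274041727938532923909405777429052685456119649553232614942810547676158,
  60134336228169239053430565786699726865070764798592811477539190011672782284778517544193034808962817392751830971211555773719674853799138179084751964993338621653386121302755119381316810861312130771157406782950266975002183674135436275166176695457251091466146015831726988940482562978908655960841410808533295156158081748941777138016553788082478079,
  60990267625183804331790561286666849898809693806490024639618911143261534054996804165868870813775955610095084776827029637381053753237066359226342950214232281018967786838429621666300579456511864709565758835877922628483484043447811301447087253024324937841687399786811450466543820012385274831303993964232156941080769659586795671225559617338598398,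
  61560897829173720109297907287909564412637668335261352070684184590420789345218466884616228006250905988755467746592912775558354600995524692098095610190384106791078974911876767420575377224751146773238761218981343552827262470676118905762061622342028329423537303760245676871235334494365574146305158562225816221450799520248102059870385858876007421,
  62131555864707125187321625642267667886039202314076091608184514066648886214468454689595877425593139811893106763250473383415701263227805501578244641675532555693421918252295332126127505816723428760106496064538286222505819058408082883566328257389803334198779057009216278853005405642521499227487476766143152951109160885390351662037711559164158973,
  60134197070478312100524276474595389362659758838194198597435551816062229322744176171000081904489487991796666045028804101962923406050059901698996723094311933665040972174442749768920510898075679422772113384251325526644803372950262168009450327356488998666084545738379341890409994025136253464726373857415984954687328369197631619887271464702839809,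
  57851425757070779546610521725422025530308539784396972669966301699646747962237997485391566325077425026668864599201256702959047683465569953431091177976139328102616990316613532732119080750986697979337629745400524835506438261333099721926983712244225264901838028603656178467174145790828864324259343330897929635059904184205879675944003611901576198,
  57966592588756403633307692198149733861483792864932518632702029466615234271783897139742514859658862627610039909510871287810916238986916887717391096706202822799992088956894285244554061134151238533089916032081241376681410570903113805945605434646526343912443821189767289265395502889529790046534601418210001996485290337725816108775756425672530946,
  59678149290185477169070708492036849756727839953935552709482025627484496497067031257179686541215552419982567826570407207235509011404687788284225369187209813664564499852050883849641980342744898903549224458338170487942582202520022273614310656966118309487218635039620846484676041562442026869144540200345470776690930030818623739812102594885581824,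
  59734313440173593229430969762551885298127295001031812532257989001363421863364150169872696319185846564500755628583104372300526177310935568895591612694569484845447852286840159842576680351545651733734982852074903166434687935797049213183299155325940109090255019399786167861626289684589292948423351197417903637900727671864715476735433614171300862,
  59676841343690043968590071827992911179538509673299267362375780827924880106855010650818435691295012543886182457738221291471915970595203967480223028077088554406166011118168001400189548273529774318433356040608799043214539976872788377655147257952095240167526999563939135221002096092132772252287189642239070815069830896600906400715088091980755966,
  59619341415676266801288228550881890412670121143857508294315223288082082934423481200247011229288278894431643713673413675466569750090059833035966983738180340548936061912862367042215465577831815675106210709841456057713166959720652538263538964148043285308204693699037329031137599811874776001671501835724520057605436515032431635794630192310254590,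
  58765024071333541480968540254319157190678759530316215757444065183847295142122595245019126326599120608052239862347559382975262394266141051879419075701543674340389257621435149681412799876140708934299657389769429659740817791107998576866952203499103424172066671035501822207440438041570928035863018708376720147099041570500172453888130409792805892,
  58024621261685016546423544057107864248631987442476913721219346074497511547718552157351070452807905709166974201308983266184691076560888972534374782528848400392795101315103975864565431048112562277798297314707754252672227491617231598815046443837424899907176564377966656060743394998971645295583599022999398149541640879283315515040907599647095818,
  58081564626836718585638082446123702704995291645792704718328649433562516064146534834011188723672896083305988512901360438539778744513865423190728865173709684854144952119470264748777583514969174402197589689667667230200071125895815933522201756617821477461268168742757770080447722316519573763732886896373691867091424563502116632955277361534743561,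
  59049406918649745206228876845897654811591431327245942289025356169988465363055116105819764214052297387365272251437473205311134978899455530644902898841015288717083230477008059326923576034360470280579240900554099041754888215941247594570548625080143066180056694686229010764143356778053579029978964124169711501655420460429863416545621378863209473,
  59561618835347714147566170765050958721188578902421266150524120722531420131291183055898764132699140764389858608219112203310811671737690298062886514595886618595560483703259602682894844534957192037863064768378412177280770257272340102085389890037012686264025256272637034103883877390580088113938651264904983018451477298405493369209023319353854973,
  59619118763368120391887067475570896165884853428863703424592214867796073849891370407099549949203390826053547307188008814925652826737064579032771737408766280085168712416081124863562504651406805717280856961818439069578587692117372252140474871319758624190832298670274442765621839670720289901983932618272025526722916335163340852193886394938033150,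
  59676590873428022627766717552524574250312873042956090865859660870110467306471830100638714034486029394127292605621396205559489345461793689581120687758883756623585505981832336794344327722597285503645433124407976773275045785928200039675759257281833111060201192783636684107816056433562337588293363305742834638663282755118819643916570293581116414,
  58878938606021106311270805482358529263176505607072651538897733068435927920270523473993291265191251216971671915892568287594109231448684835606972483387817233123392648070325143205447176608302204100470746305113979613375262710557387253446548992844662801089468087796674124021246647069960668635922320469719553013915756596363940719095043279770622979,
  57284218479189220215201133906043923524172254000427927529549259443460824448342117403592129509906751561925128242767203693701681476937755122612488141755695739196682034631708426570680391545084166218923540378686080924384729353100738785798971031435680577525013973705589684613388028030046914071388085570475212879374620741236394237978384889005741061,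
  56714729232460340807467128259619599570775611669135262895754208495049834742537039835192820783448703830628236313796485033001396356015972841783879371495391073580322411648527123392145595556279538598456318698259161523206053292803659436695382302260979165799243954459618523396458938898426126358530860717179039897714401515473205746073980599053315072,
  56828699443804663160159019530151938180832830385597342128299994375243108820017355178298813343161036787669478911804637913204474162878202901112197006641171471033030356883104837114998809312233934676481092877172119613788995837517055155744194651515686320426695783419204249332674067955417876307042733760624308900157231511879863444985570305199008746,
  56942697473109308262211971494942703957757662699286649473332006667134663192226425313970514936755439752310917145167267555287165277609782007473589602408684474500991603781673299553819405895266528675483686395606006835785207105863384853866105226138751186467654474305967500714504023688028068332296278145035212694494064816151234507668166178909381589,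
  56771700429155376781292296638913663805904625468299352290507712946663055765948942272258580479756423199175700079818929493010540182048894106781360623106399202844994975609234352578556158270261479408117626856089754874922721888255117795234421668325545292019400760340416223149851256238202109321586485815654628541137565103010448606873779014125728758,
  56600759048275379465177719606161682804474570209980673581025495871853282823254981187141000899637741654028303304629593169291512706823510298988442677713788547117680785361075653928176508300768310924517395277095335461916912092440863289165283633099921565033327153722170317325485532360884559553732142369477503314543038997526576311765747081702030347,
  56486761018977178850914082677830866887443230300854595241112494215034621264770137598289279537391362120508477764216330982032895874228097625240286289116162136717188032717708698099928658209116946264760606371680143511933845036311174002955817779764988922132823025882518670849957343226126588510382538746285872509133141963822824359574195765965276193,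
  56999418199542507395980550033403983062780039431321530632300785465924906003011310060066893383936037470947888076387963961662542871701840080592366737593438093630957076967555004488286216977379957559174571696168510080632806515992643315207122815523360919693414111684863438954537891682467113241187369292081709362998367669642579395903818604480590868,
  57796792192303257805638194426200779432668829988255051142671411123916290992687765614761206064907733120883790269162642585049658742318249416762033030717842175096832802805843213370504202199001515916937132047333030265083224587195086139745965007313672382961849910858434716071790071881651409990934202646020629498115422209805281239810142012365091849,
  57853735543878606872975744906227485855189864342188449011893606361913559366600408091126048049430674880340187129651026880615673887743465345282196178595472828574575020993705401629707547755863199928655525839575183237325735064614012139217812574948184737020937301364121298556637149645833847419876834198462128672195270425648525654562162675749501962,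
  57284246297149727463660471655851842242531018932367173198782768345499764259563150440587408634289695513079947436162929923813202411713846975029025848481187529783617883395129166537340259302202019369971985167426101789085574802623493183293528849153944278919680849093151243090801831736305927554966228304861357065494330239159285219991057681449227268,
  60249028347982576912614493449265470472952946061453192542213152786859086127648678947297527947442534198072577445960163918550466951582563322289153976989662019811808562167891519047198570491915704912761476156352585375435635899247129325574523461147028927798255771276429528163296958129259470459853502390819994941426726616247216093384919527169461248]

def nmcx (i : ℕ) : ℤ := ((nmCX / 10 ^ (11 * i) % 10 ^ 11 : ℕ) : ℤ) - 50000000000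
def nmcy (i : ℕ) : ℤ := ((nmCY / 10 ^ (11 * i) % 10 ^ 11 : ℕ) : ℤ) - 50000000000
def nmax (i f : ℕ) : ℤ := ((nmAX.getD i 0 / 2048 ^ f % 2048 : ℕ) : ℤ) - 1024
def nmay (i f : ℕ) : ℤ := ((nmAY.getD i 0 / 2048 ^ f % 2048 : ℕ) : ℤ) - 1024
def nmeu (e : ℕ) : Fin 53 := Fin.ofNat 53 (nmEU / 100 ^ e % 100)
def nmev (e : ℕ) : Fin 53 := Fin.ofNat 53 (nmEV / 100 ^ e % 100)

def nmSum (g : ℕ → ℕ) : ℕ → ℕ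
  | 0 => 0
  | n + 1 => nmSum g n + g n

def nmAll (g : ℕ → Bool) : ℕ → Bool
  | 0 => true
  | n + 1 => g n && nmAll g n

theorem nmSum_eq (g : ℕ → ℕ) (n : ℕ) : nmSum g n = ∑ i : Fin n, g i := by
  induction n with
  | zero => simp [nmSum]
  | succ n ih => rw [nmSum, ih, Fin.sum_univ_castSucc]; simp

theorem nmAll_spec {g : ℕ → Bool} {n : ℕ} (h : nmAll g n = true) : ∀ i, i < n → g i = true := by
  induction n with
  | zero => intro i hi; omega
  | succ n ih =>
    rw [nmAll, Bool.and_eq_true] at h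
    intro i hi
    rcases Nat.lt_succ_iff_lt_or_eq.mp hi with h1 | h1
    · exact ih h.2 i h1
    · rw [h1]; exact h.1

theorem nmSum_real (z : ℕ → ℤ) (n B : ℕ) (h : nmSum (fun f => (z f).natAbs) n ≤ B) :
    ∑ f : Fin n, |(z f : ℝ)| ≤ B := by
  rw [nmSum_eq] at h
  have h' : ((∑ f : Fin n, (z f).natAbs : ℕ) : ℝ) ≤ B := by exact_mod_cast h
  rw [Nat.cast_sum] at h'
  refine le_trans (le_of_eq ?_) h'
  refine Finset.sum_congr rfl fun f _ => ?_
  rw [Nat.cast_natAbs]; push_cast; rfl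

-- integer data attached to an edge
def nmdx (e : ℕ) : ℤ := nmcx (nmeu e) - nmcx (nmev e)
def nmdy (e : ℕ) : ℤ := nmcy (nmeu e) - nmcy (nmev e)
def nmmx (e f : ℕ) : ℤ := nmax (nmeu e) f - nmax (nmev e) f
def nmmy (e f : ℕ) : ℤ := nmay (nmeu e) f - nmay (nmev e) f
def nmres (e f : ℕ) : ℤ :=
  2 * (nmdx e * nmmx e f + nmdy e * nmmy e f) - bif Nat.beq e f then 2560000000000 else 0

def nmchk0 (e : ℕ) : Bool :=
  Nat.ble (nmdx e * nmdx e + nmdy e * nmdy e - 100000000000000000000).natAbs 100000000000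
def nmchk1 (e : ℕ) : Bool := Nat.ble (nmSum (fun f => (nmres e f).natAbs) 103) 1024000000000
def nmchk2 (i : ℕ) : Bool :=
  Nat.ble (nmSum (fun f => (nmax i f).natAbs) 103) 7936 &&
  Nat.ble (nmSum (fun f => (nmay i f).natAbs) 103) 7936

theorem nmh0 : nmAll nmchk0 103 = true := by decide +kernel
theorem nmh1 : nmAll nmchk1 103 = true := by decide +kernel
theorem nmh2 : nmAll nmchk2 53 = true := by decide +kernel

-- strict positivity of an integer functional with error margin
def nmgap (m n t : ℤ) : Bool := decide (20000 * (|m| + |n|) < t)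
def nmsep (m n : ℤ) (a b c d : ℕ) : Bool :=
  nmgap m n (m * (nmcx c - nmcx a) + n * (nmcy c - nmcy a)) &&
  nmgap m n (m * (nmcx d - nmcx a) + n * (nmcy d - nmcy a)) &&
  nmgap m n (m * (nmcx c - nmcx b) + n * (nmcy c - nmcy b)) &&
  nmgap m n (m * (nmcx d - nmcx b) + n * (nmcy d - nmcy b))
def nmsep4 (a b c d : ℕ) : Bool :=
  nmsep (nmcx b - nmcx a) (nmcy b - nmcy a) a b c d ||
  nmsep (nmcx a - nmcx b) (nmcy a - nmcy b) a b c d ||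
  nmsep (nmcy b - nmcy a) (nmcx a - nmcx b) a b c d ||
  nmsep (nmcy a - nmcy b) (nmcx b - nmcx a) a b c d
def nmadj (s q r : ℕ) : Bool :=
  nmgap (nmcx q - nmcx r) (nmcy q - nmcy r)
    ((nmcx q - nmcx r) * (nmcx q - nmcx s) + (nmcy q - nmcy r) * (nmcy q - nmcy s)) &&
  nmgap (nmcx q - nmcx r) (nmcy q - nmcy r)
    ((nmcx q - nmcx r) * (nmcx s - nmcx r) + (nmcy q - nmcy r) * (nmcy s - nmcy r))
def nmpair (a b c d : ℕ) : Bool :=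
  bif Nat.beq a c then nmadj a b d else
  bif Nat.beq a d then nmadj a b c else
  bif Nat.beq b c then nmadj b a d else
  bif Nat.beq b d then nmadj b a c else
  nmsep4 a b c d || nmsep4 c d a b
def nmchk3 (e : ℕ) : Bool :=
  nmAll (fun f => nmpair (nmeu e) (nmev e) (nmeu f) (nmev f)) e
theorem nmh3 : nmAll nmchk3 106 = true := by decide +kernel

def nmchk4 (i : ℕ) : Bool :=
  nmAll (fun j => Nat.blt 30000 (nmcx i - nmcx j).natAbs || Nat.blt 30000 (nmcy i - nmcy j).natAbs) i
theorem nmh4 : nmAll nmchk4 53 = true := by decide +kernel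

def nmedge (e : Fin 106) : Fin 53 × Fin 53 := (nmeu e, nmev e)
theorem nmedge_inj : ∀ i j : Fin 106, nmedge i = nmedge j → i = j := by decide +kernel
theorem nmedge_lt : ∀ i : Fin 106, nmeu i < nmev i := by decide +kernel
theorem nmdeg : ∀ v : Fin 53,
    ((Finset.univ : Finset (Fin 106)).filter (fun i : Fin 106 => nmeu i = v ∨ nmev i = v)).card = 4 := by
  decide +kernel
theorem nmcard : ((Finset.univ : Finset (Fin 106)).filter (fun i : Fin 106 => (i : ℕ) < 103)).card = 103 := by
  decide +kernel
def nmchk5 (e : ℕ) : Bool :=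
  decide (nmdx e * nmdx e + nmdy e * nmdy e < 99990000000000000000) &&
  decide (97000000000000000000 < nmdx e * nmdx e + nmdy e * nmdy e)
    && decide (|nmdx e| < 20000000000) && decide (|nmdy e| < 20000000000)
theorem nmh5 : nmchk5 103 = true ∧ nmchk5 104 = true ∧ nmchk5 105 = true := by decide +kernel

-- the contraction argument
theorem nm_exists {m : ℕ} (D1 D2 : Fin m → ℝ) (M1 M2 : Fin m → Fin m → ℝ)
    (h1 : ∀ e, ∑ f, |2 * (D1 e * M1 e f + D2 e * M2 e f) - (if e = f then 1 else 0)| ≤ 2 / 5)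
    (h21 : ∀ e, ∑ f, |M1 e f| ≤ 100) (h22 : ∀ e, ∑ f, |M2 e f| ≤ 100)
    (h0 : ∀ e, |D1 e ^ 2 + D2 e ^ 2 - 1| ≤ 1 / 10 ^ 9) :
    ∃ y : Fin m → ℝ, (∀ f, |y f| ≤ 1 / 10 ^ 8) ∧
      ∀ e, (D1 e + ∑ f, M1 e f * y f) ^ 2 + (D2 e + ∑ f, M2 e f * y f) ^ 2 = 1 := by
  have key : ∀ (g : Fin m → ℝ) (w : Fin m → ℝ) (B r : ℝ), 0 ≤ r → (∑ f, |g f| ≤ B) →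
      (∀ f, |w f| ≤ r) → |∑ f, g f * w f| ≤ B * r := by
    intro g w B r hr hg hw
    calc |∑ f, g f * w f| ≤ ∑ f, |g f * w f| := Finset.abs_sum_le_sum_abs _ _
      _ ≤ ∑ f, |g f| * r := Finset.sum_le_sum fun f _ => by
          rw [abs_mul]; exact mul_le_mul_of_nonneg_left (hw f) (abs_nonneg _)
      _ = (∑ f, |g f|) * r := by rw [Finset.sum_mul]
      _ ≤ B * r := mul_le_mul_of_nonneg_right hg hr
  let T : (Fin m → ℝ) → (Fin m → ℝ) := fun y e =>
    y e - ((D1 e + ∑ f, M1 e f * y f) ^ 2 + (D2 e + ∑ f, M2 e f * y f) ^ 2 - 1)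
  let s : Set (Fin m → ℝ) := Metric.closedBall 0 (1 / 10 ^ 8)
  have hs : ∀ y ∈ s, ∀ f, |y f| ≤ 1 / 10 ^ 8 := by
    intro y hy f
    have := (dist_pi_le_iff (by norm_num)).1 (Metric.mem_closedBall.1 hy) f
    simpa [Real.dist_eq] using this
  have hlip : ∀ y ∈ s, ∀ z ∈ s, dist (T y) (T z) ≤ 1 / 2 * dist y z := by
    intro y hy z hz
    have hr : 0 ≤ dist y z := dist_nonneg
    refine (dist_pi_le_iff (by positivity)).2 fun e => ?_
    have hw : ∀ f, |y f - z f| ≤ dist y z := fun f => by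
      rw [← Real.dist_eq]; exact dist_le_pi_dist y z f
    have hv : ∀ f, |y f + z f| ≤ 2 / 10 ^ 8 := fun f => by
      have a1 := hs y hy f
      have a2 := hs z hz f
      have := abs_add_le (y f) (z f)
      linarith
    have k1 := key _ _ _ _ hr (h1 e) hw
    have k2 := key _ _ _ _ hr (h21 e) hw
    have k3 := key _ _ _ _ hr (h22 e) hw
    have k4 := key _ _ _ (2 / 10 ^ 8) (by norm_num) (h21 e) hv
    have k5 := key _ _ _ (2 / 10 ^ 8) (by norm_num) (h22 e) hv
    have i1 : ∑ f, (2 * (D1 e * M1 e f + D2 e * M2 e f) - (if e = f then 1 else 0)) * (y f - z f)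
        = 2 * (D1 e * ∑ f, M1 e f * (y f - z f)) + 2 * (D2 e * ∑ f, M2 e f * (y f - z f))
          - (y e - z e) := by
      have : (y e - z e) = ∑ f, (if e = f then (1 : ℝ) else 0) * (y f - z f) := by
        simp
      rw [this]
      simp only [Finset.mul_sum]
      rw [← Finset.sum_add_distrib, ← Finset.sum_sub_distrib]
      refine Finset.sum_congr rfl fun f _ => ?_
      ring
    have i2 : ∀ g : Fin m → ℝ, ∑ f, g f * (y f - z f) = ∑ f, g f * y f - ∑ f, g f * z f := by
      intro g; rw [← Finset.sum_sub_distrib]; exact Finset.sum_congr rfl fun f _ => by ring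
    have i3 : ∀ g : Fin m → ℝ, ∑ f, g f * (y f + z f) = ∑ f, g f * y f + ∑ f, g f * z f := by
      intro g; rw [← Finset.sum_add_distrib]; exact Finset.sum_congr rfl fun f _ => by ring
    have i4 : T y e - T z e =
        -(∑ f, (2 * (D1 e * M1 e f + D2 e * M2 e f) - (if e = f then 1 else 0)) * (y f - z f))
        - (∑ f, M1 e f * (y f - z f)) * (∑ f, M1 e f * (y f + z f))
        - (∑ f, M2 e f * (y f - z f)) * (∑ f, M2 e f * (y f + z f)) := by
      rw [i1]
      simp only [i2, i3, T]
      ring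
    have k6 : |(∑ f, M1 e f * (y f - z f)) * (∑ f, M1 e f * (y f + z f))|
        ≤ (100 * dist y z) * (100 * (2 / 10 ^ 8)) := by
      rw [abs_mul]; exact mul_le_mul k2 k4 (abs_nonneg _) (by positivity)
    have k7 : |(∑ f, M2 e f * (y f - z f)) * (∑ f, M2 e f * (y f + z f))|
        ≤ (100 * dist y z) * (100 * (2 / 10 ^ 8)) := by
      rw [abs_mul]; exact mul_le_mul k3 k5 (abs_nonneg _) (by positivity)
    rw [Real.dist_eq, i4]
    rw [abs_le] at k1 k6 k7 ⊢
    constructor <;> linarith [k1.1, k1.2, k6.1, k6.2, k7.1, k7.2]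
  have h0s : (0 : Fin m → ℝ) ∈ s := Metric.mem_closedBall_self (by norm_num)
  have hT0 : dist (T 0) 0 ≤ 1 / 10 ^ 9 := by
    refine (dist_pi_le_iff (by norm_num)).2 fun e => ?_
    have := h0 e
    rw [Real.dist_eq]
    have hh : T 0 e - (0 : Fin m → ℝ) e = -(D1 e ^ 2 + D2 e ^ 2 - 1) := by
      simp [T]
    rw [hh, abs_neg]
    exact this
  have hmaps : Set.MapsTo T s s := by
    intro y hy
    have a1 := hlip y hy 0 h0s
    have a2 : dist y 0 ≤ 1 / 10 ^ 8 := hy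
    have a3 := dist_triangle (T y) (T 0) 0
    show dist (T y) 0 ≤ 1 / 10 ^ 8
    linarith
  have hc : ContractingWith (1 / 2 : NNReal) (hmaps.restrict T s s) := by
    refine ⟨by rw [div_lt_one] <;> norm_num, LipschitzWith.of_dist_le_mul fun a b => ?_⟩
    have := hlip a a.2 b b.2
    simpa [Subtype.dist_eq] using this
  obtain ⟨y, hy, hfix, -⟩ := hc.exists_fixedPoint' (Metric.isClosed_closedBall.isComplete) hmaps
    h0s (edist_ne_top _ _)
  refine ⟨y, hs y hy, fun e => ?_⟩
  have h := congrFun hfix.eq e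
  simp only [T] at h
  linarith

-- real coordinates in units of 10^-10
noncomputable def nmX (y : Fin 103 → ℝ) (i : ℕ) : ℝ :=
  (nmcx i : ℝ) / 10 ^ 10 + ∑ f : Fin 103, (nmax i f : ℝ) / 256 * y f
noncomputable def nmY (y : Fin 103 → ℝ) (i : ℕ) : ℝ :=
  (nmcy i : ℝ) / 10 ^ 10 + ∑ f : Fin 103, (nmay i f : ℝ) / 256 * y f

theorem nm_row (a : ℕ → ℤ) (h : Nat.ble (nmSum (fun f => (a f).natAbs) 103) 7936 = true) :
    ∑ f : Fin 103, |(a f : ℝ) / 256| ≤ 31 := by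
  have := nmSum_real a 103 7936 (Nat.le_of_ble_eq_true h)
  have e : ∑ f : Fin 103, |(a f : ℝ) / 256| = (∑ f : Fin 103, |(a f : ℝ)|) / 256 := by
    rw [Finset.sum_div]
    exact Finset.sum_congr rfl fun f _ => by rw [abs_div]; norm_num
  rw [e]
  push_cast at this
  linarith

theorem nm_row_bound (y : Fin 103 → ℝ) (hy : ∀ f, |y f| ≤ 1 / 10 ^ 8) (g : Fin 103 → ℝ)
    (hg : ∑ f, |g f| ≤ 31) : |∑ f, g f * y f| ≤ 1 / 10 ^ 6 := by
  calc |∑ f, g f * y f| ≤ ∑ f, |g f * y f| := Finset.abs_sum_le_sum_abs _ _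
      _ ≤ ∑ f, |g f| * (1 / 10 ^ 8) := Finset.sum_le_sum fun f _ => by
          rw [abs_mul]; exact mul_le_mul_of_nonneg_left (hy f) (abs_nonneg _)
      _ = (∑ f, |g f|) * (1 / 10 ^ 8) := by rw [Finset.sum_mul]
      _ ≤ 1 / 10 ^ 6 := by linarith

theorem nm_sol : ∃ y : Fin 103 → ℝ, (∀ f, |y f| ≤ 1 / 10 ^ 8) ∧ ∀ e : ℕ, e < 103 →
    (nmX y (nmeu e) - nmX y (nmev e)) ^ 2 + (nmY y (nmeu e) - nmY y (nmev e)) ^ 2 = 1 := by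
  have hrow : ∀ i : Fin 53, (∑ f : Fin 103, |(nmax i f : ℝ) / 256| ≤ 31) ∧
      (∑ f : Fin 103, |(nmay i f : ℝ) / 256| ≤ 31) := by
    intro i
    have := nmAll_spec nmh2 i i.2
    rw [nmchk2, Bool.and_eq_true] at this
    exact ⟨nm_row _ this.1, nm_row _ this.2⟩
  have hdiff : ∀ g h : Fin 103 → ℝ, ∑ f, |g f| ≤ 31 → ∑ f, |h f| ≤ 31 →
      ∑ f, |g f - h f| ≤ 100 := by
    intro g h hg hh
    have : ∑ f, |g f - h f| ≤ ∑ f, (|g f| + |h f|) :=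
      Finset.sum_le_sum fun f _ => abs_sub _ _
    rw [Finset.sum_add_distrib] at this
    linarith
  obtain ⟨y, hy, h⟩ := nm_exists (m := 103)
    (fun e => (nmdx e : ℝ) / 10 ^ 10) (fun e => (nmdy e : ℝ) / 10 ^ 10)
    (fun e f => (nmax (nmeu e) f : ℝ) / 256 - (nmax (nmev e) f : ℝ) / 256)
    (fun e f => (nmay (nmeu e) f : ℝ) / 256 - (nmay (nmev e) f : ℝ) / 256)
    (by
      intro e
      have h := nmSum_real (nmres e) 103 _ (Nat.le_of_ble_eq_true (nmAll_spec nmh1 e e.2))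
      have key : ∀ f : Fin 103, |2 * ((nmdx e : ℝ) / 10 ^ 10 *
          ((nmax (nmeu e) f : ℝ) / 256 - (nmax (nmev e) f : ℝ) / 256) +
          (nmdy e : ℝ) / 10 ^ 10 *
          ((nmay (nmeu e) f : ℝ) / 256 - (nmay (nmev e) f : ℝ) / 256)) - (if e = f then 1 else 0)|
          = |(nmres e f : ℝ)| / 2560000000000 := by
        intro f
        have h2 : |(nmres e f : ℝ)| / 2560000000000 = |(nmres e f : ℝ) / 2560000000000| := by
          rw [abs_div]; norm_num
        rw [h2]
        congr 1
        unfold nmres nmmx nmmy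
        by_cases hef : e = f
        · subst hef
          rw [if_pos rfl, Nat.beq_refl, cond_true]
          push_cast; ring
        · rw [if_neg hef]
          have : Nat.beq e f = false := by
            rw [Bool.eq_false_iff]
            intro hb
            exact hef (Fin.ext (Nat.eq_of_beq_eq_true hb))
          rw [this, cond_false]
          push_cast; ring
      rw [Finset.sum_congr rfl fun f _ => key f, ← Finset.sum_div]
      push_cast at h
      rw [div_le_iff₀ (by norm_num)]
      linarith)
    (fun e => hdiff _ _ (hrow (nmeu e)).1 (hrow (nmev e)).1)
    (fun e => hdiff _ _ (hrow (nmeu e)).2 (hrow (nmev e)).2)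
    (by
      intro e
      have h := Nat.le_of_ble_eq_true (nmAll_spec nmh0 e e.2)
      have h' : |(nmdx e * nmdx e + nmdy e * nmdy e - 100000000000000000000)| ≤ 100000000000 := by
        rw [Int.abs_eq_natAbs]; exact_mod_cast h
      have h2 : |((nmdx e : ℝ) * nmdx e + nmdy e * nmdy e - 100000000000000000000)|
          ≤ 100000000000 := by exact_mod_cast h'
      rw [abs_le] at h2 ⊢
      constructor <;> nlinarith [h2.1, h2.2])
  refine ⟨y, hy, fun e he => ?_⟩
  have h := h ⟨e, he⟩
  simp only [sub_mul, Finset.sum_sub_distrib] at h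
  rw [← h]
  simp only [nmX, nmY, nmdx, nmdy]
  push_cast
  ring

theorem nm_gap {m n : ℤ} {i j : ℕ} {X Y : ℕ → ℝ}
    (hX : ∀ k ∈ ({i, j} : Set ℕ), |X k - (nmcx k : ℝ) / 10 ^ 10| ≤ 1 / 10 ^ 6)
    (hY : ∀ k ∈ ({i, j} : Set ℕ), |Y k - (nmcy k : ℝ) / 10 ^ 10| ≤ 1 / 10 ^ 6)
    (h : nmgap m n (m * (nmcx j - nmcx i) + n * (nmcy j - nmcy i)) = true) :
    (m : ℝ) * X i + n * Y i < m * X j + n * Y j := by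
  have h' := of_decide_eq_true h
  have h2 : 20000 * (|(m : ℝ)| + |(n : ℝ)|) <
      m * ((nmcx j : ℝ) - nmcx i) + n * ((nmcy j : ℝ) - nmcy i) := by exact_mod_cast h'
  have b : ∀ (m u : ℝ), |u| ≤ 1 / 10 ^ 6 → |m * u| ≤ |m| / 10 ^ 6 := by
    intro m u hu
    rw [abs_mul]
    have := mul_le_mul_of_nonneg_left hu (abs_nonneg m)
    linarith
  have a1 := abs_le.1 (b m _ (hX i (by simp)))
  have a2 := abs_le.1 (b m _ (hX j (by simp)))
  have a3 := abs_le.1 (b n _ (hY i (by simp)))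
  have a4 := abs_le.1 (b n _ (hY j (by simp)))
  nlinarith [a1.1, a1.2, a2.1, a2.2, a3.1, a3.2, a4.1, a4.2]

-- values of a linear functional on a segment
theorem nm_seg {p q x : EuclideanSpace ℝ (Fin 2)} (h : x ∈ segment ℝ p q) :
    ∃ a b : ℝ, 0 ≤ a ∧ 0 ≤ b ∧ a + b = 1 ∧ a • p + b • q = x ∧ ∀ m n : ℝ,
      m * x 0 + n * x 1 = a * (m * p 0 + n * p 1) + b * (m * q 0 + n * q 1) := by
  obtain ⟨a, b, ha, hb, hab, rfl⟩ := h
  refine ⟨a, b, ha, hb, hab, rfl, fun m n => ?_⟩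
  simp only [PiLp.add_apply, PiLp.smul_apply, smul_eq_mul]
  ring

theorem nm_disj {p q r s x : EuclideanSpace ℝ (Fin 2)} (m n : ℝ)
    (h1 : m * p 0 + n * p 1 < m * r 0 + n * r 1) (h2 : m * p 0 + n * p 1 < m * s 0 + n * s 1)
    (h3 : m * q 0 + n * q 1 < m * r 0 + n * r 1) (h4 : m * q 0 + n * q 1 < m * s 0 + n * s 1)
    (hx : x ∈ segment ℝ p q) (hx' : x ∈ segment ℝ r s) : False := by
  obtain ⟨a, b, ha, hb, hab, -, e1⟩ := nm_seg hx
  obtain ⟨c, d, hc, hd, hcd, -, e2⟩ := nm_seg hx'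
  have e1 := e1 m n
  have e2 := e2 m n
  set u := m * p 0 + n * p 1
  set v := m * q 0 + n * q 1
  set w := m * r 0 + n * r 1
  set z := m * s 0 + n * s 1
  have l1 : a * u + b * v ≤ max u v := by
    have := mul_le_mul_of_nonneg_left (le_max_left u v) ha
    have := mul_le_mul_of_nonneg_left (le_max_right u v) hb
    have : a * max u v + b * max u v = max u v := by rw [← add_mul, hab, one_mul]
    linarith
  have l2 : min w z ≤ c * w + d * z := by
    have := mul_le_mul_of_nonneg_left (min_le_left w z) hc
    have := mul_le_mul_of_nonneg_left (min_le_right w z) hd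
    have : c * min w z + d * min w z = min w z := by rw [← add_mul, hcd, one_mul]
    linarith
  have : max u v < min w z := max_lt (lt_min h1 h2) (lt_min h3 h4)
  linarith

theorem nm_common {p q r x : EuclideanSpace ℝ (Fin 2)} (m n : ℝ)
    (h1 : m * p 0 + n * p 1 < m * q 0 + n * q 1) (h2 : m * r 0 + n * r 1 < m * p 0 + n * p 1)
    (hx : x ∈ segment ℝ p q) (hx' : x ∈ segment ℝ p r) : x = p := by
  obtain ⟨a, b, ha, hb, hab, hxx, e1⟩ := nm_seg hx
  obtain ⟨c, d, hc, hd, hcd, -, e2⟩ := nm_seg hx'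
  have e1 := e1 m n
  have e2 := e2 m n
  have hb0 : b = 0 := by
    by_contra hne
    have hb' : 0 < b := lt_of_le_of_ne hb (Ne.symm hne)
    have := mul_lt_mul_of_pos_left h1 hb'
    have h3 := mul_le_mul_of_nonneg_left h2.le hd
    have t1 : a * (m * p 0 + n * p 1) + b * (m * p 0 + n * p 1) = m * p 0 + n * p 1 := by
      rw [← add_mul, hab, one_mul]
    have t2 : c * (m * p 0 + n * p 1) + d * (m * p 0 + n * p 1) = m * p 0 + n * p 1 := by
      rw [← add_mul, hcd, one_mul]
    linarith
  have ha1 : a = 1 := by linarith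
  rw [← hxx, hb0, ha1]; simp

theorem nm_pair (P : ℕ → EuclideanSpace ℝ (Fin 2)) (a b c d : ℕ)
    (hX : ∀ k, k < 53 → |P k 0 - (nmcx k : ℝ) / 10 ^ 10| ≤ 1 / 10 ^ 6)
    (hY : ∀ k, k < 53 → |P k 1 - (nmcy k : ℝ) / 10 ^ 10| ≤ 1 / 10 ^ 6)
    (ha : a < 53) (hb : b < 53) (hc : c < 53) (hd : d < 53)
    (h : nmpair a b c d = true) (x : EuclideanSpace ℝ (Fin 2))
    (hx : x ∈ segment ℝ (P a) (P b)) (hx' : x ∈ segment ℝ (P c) (P d)) :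
    (x = P a ∨ x = P b) ∧ (x = P c ∨ x = P d) := by
  have gap : ∀ (m n : ℤ) (i j : ℕ), i < 53 → j < 53 →
      nmgap m n (m * (nmcx j - nmcx i) + n * (nmcy j - nmcy i)) = true →
      (m : ℝ) * P i 0 + n * P i 1 < m * P j 0 + n * P j 1 := by
    intro m n i j hi hj hg
    refine nm_gap (X := fun k => P k 0) (Y := fun k => P k 1) ?_ ?_ hg
    · rintro k (rfl | rfl)
      · exact hX _ hi
      · exact hX _ hj
    · rintro k (rfl | rfl)
      · exact hY _ hi
      · exact hY _ hj
  have adj : ∀ s q r : ℕ, s < 53 → q < 53 → r < 53 → nmadj s q r = true →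
      x ∈ segment ℝ (P s) (P q) → x ∈ segment ℝ (P s) (P r) → x = P s := by
    intro s q r hs hq hr hh h1 h2
    rw [nmadj, Bool.and_eq_true] at hh
    exact nm_common _ _ (gap _ _ _ _ hs hq hh.1) (gap _ _ _ _ hr hs hh.2) h1 h2
  have sep : ∀ (m n : ℤ) (a b c d : ℕ), a < 53 → b < 53 → c < 53 → d < 53 →
      nmsep m n a b c d = true →
      x ∈ segment ℝ (P a) (P b) → x ∈ segment ℝ (P c) (P d) → False := by
    intro m n a b c d ha hb hc hd hh h1 h2
    simp only [nmsep, Bool.and_eq_true] at hh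
    exact nm_disj _ _ (gap _ _ _ _ ha hc hh.1.1.1) (gap _ _ _ _ ha hd hh.1.1.2)
      (gap _ _ _ _ hb hc hh.1.2) (gap _ _ _ _ hb hd hh.2) h1 h2
  have sep4 : ∀ (a b c d : ℕ), a < 53 → b < 53 → c < 53 → d < 53 →
      nmsep4 a b c d = true →
      x ∈ segment ℝ (P a) (P b) → x ∈ segment ℝ (P c) (P d) → False := by
    intro a b c d ha hb hc hd hh h1 h2
    simp only [nmsep4, Bool.or_eq_true] at hh
    rcases hh with ((hh | hh) | hh) | hh
    all_goals exact sep _ _ _ _ _ _ ha hb hc hd hh h1 h2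
  have beq : ∀ {i j : ℕ}, Nat.beq i j = true → i = j := fun h => Nat.eq_of_beq_eq_true h
  unfold nmpair at h
  cases h1 : Nat.beq a c with
  | true =>
    rw [h1, cond_true] at h
    obtain rfl := beq h1
    have := adj _ _ _ ha hb hd h hx hx'
    exact ⟨Or.inl this, Or.inl this⟩
  | false =>
    rw [h1, cond_false] at h
    cases h2 : Nat.beq a d with
    | true =>
      rw [h2, cond_true] at h
      obtain rfl := beq h2
      rw [segment_symm] at hx'
      have := adj _ _ _ ha hb hc h hx hx'
      exact ⟨Or.inl this, Or.inr this⟩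
    | false =>
      rw [h2, cond_false] at h
      cases h3 : Nat.beq b c with
      | true =>
        rw [h3, cond_true] at h
        obtain rfl := beq h3
        rw [segment_symm] at hx
        have := adj _ _ _ hb ha hd h hx hx'
        exact ⟨Or.inr this, Or.inl this⟩
      | false =>
        rw [h3, cond_false] at h
        cases h4 : Nat.beq b d with
        | true =>
          rw [h4, cond_true] at h
          obtain rfl := beq h4
          rw [segment_symm] at hx hx'
          have := adj _ _ _ hb ha hc h hx hx'
          exact ⟨Or.inr this, Or.inr this⟩
        | false =>
          rw [h4, cond_false, Bool.or_eq_true] at h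
          rcases h with h | h
          · exact (sep4 _ _ _ _ ha hb hc hd h hx hx').elim
          · exact (sep4 _ _ _ _ hc hd ha hb h hx' hx).elim

theorem nm_drop (e : ℕ) (h : nmchk5 e = true) (U V : ℝ)
    (hU : |U - (nmdx e : ℝ) / 10 ^ 10| ≤ 2 / 10 ^ 6) (hV : |V - (nmdy e : ℝ) / 10 ^ 10| ≤ 2 / 10 ^ 6) :
    √(U ^ 2 + V ^ 2) ≠ 1 ∧ |√(U ^ 2 + V ^ 2) - 1| < 0.02 := by
  simp only [nmchk5, Bool.and_eq_true, decide_eq_true_eq] at h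
  obtain ⟨⟨⟨h1, h2⟩, h3⟩, h4⟩ := h
  have h1 : (nmdx e : ℝ) * nmdx e + nmdy e * nmdy e < 99990000000000000000 := by exact_mod_cast h1
  have h2 : 97000000000000000000 < (nmdx e : ℝ) * nmdx e + nmdy e * nmdy e := by exact_mod_cast h2
  have h3 : |(nmdx e : ℝ)| < 20000000000 := by exact_mod_cast h3
  have h4 : |(nmdy e : ℝ)| < 20000000000 := by exact_mod_cast h4
  have sq : ∀ (U d : ℝ), |U - d / 10 ^ 10| ≤ 2 / 10 ^ 6 → |d| < 20000000000 →
      |U ^ 2 - d * d / 10 ^ 20| ≤ 1 / 10 ^ 5 := by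
    intro U d hu hd
    have e1 : U ^ 2 - d * d / 10 ^ 20 = (U - d / 10 ^ 10) * ((U - d / 10 ^ 10) + 2 * (d / 10 ^ 10)) := by
      ring
    have e2 : |(U - d / 10 ^ 10) + 2 * (d / 10 ^ 10)| ≤ 5 := by
      rw [abs_le] at hu ⊢
      rw [abs_lt] at hd
      constructor <;> linarith [hu.1, hu.2, hd.1, hd.2]
    rw [e1, abs_mul]
    have := mul_le_mul hu e2 (abs_nonneg _) (by norm_num)
    linarith
  have s1 := abs_le.1 (sq U _ hU h3)
  have s2 := abs_le.1 (sq V _ hV h4)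
  have u1 : U ^ 2 + V ^ 2 < 1 := by linarith [s1.1, s1.2, s2.1, s2.2]
  have u2 : 0.965 < U ^ 2 + V ^ 2 := by norm_num; linarith [s1.1, s1.2, s2.1, s2.2]
  have r1 : √(U ^ 2 + V ^ 2) < 1 := by
    rw [Real.sqrt_lt' one_pos]; simpa using u1
  have r2 : 0.981 < √(U ^ 2 + V ^ 2) := by
    apply Real.lt_sqrt_of_sq_lt
    norm_num at u2 ⊢; linarith
  refine ⟨r1.ne, ?_⟩
  rw [abs_lt]
  constructor <;> norm_num at r2 ⊢ <;> linarith

theorem near_matchstick_53 :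
    ∃ (P : Fin 53 → EuclideanSpace ℝ (Fin 2)) (E : Finset (Fin 53 × Fin 53)),
      Function.Injective P ∧
      (∀ e ∈ E, e.1 < e.2) ∧
      E.card = 106 ∧
      (∀ v : Fin 53, (E.filter (fun e => e.1 = v ∨ e.2 = v)).card = 4) ∧
      (∀ e ∈ E, ∀ f ∈ E, e ≠ f →
        ∀ x ∈ segment ℝ (P e.1) (P e.2) ∩ segment ℝ (P f.1) (P f.2),
          (x = P e.1 ∨ x = P e.2) ∧ (x = P f.1 ∨ x = P f.2)) ∧
      (E.filter (fun e => dist (P e.1) (P e.2) = 1)).card = 103 ∧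
      (∀ e ∈ E, dist (P e.1) (P e.2) = 1 ∨ |dist (P e.1) (P e.2) - 1| < 0.02) := by
  obtain ⟨y, hy, hsol⟩ := nm_sol
  have hrow : ∀ i, i < 53 → |nmX y i - (nmcx i : ℝ) / 10 ^ 10| ≤ 1 / 10 ^ 6 ∧
      |nmY y i - (nmcy i : ℝ) / 10 ^ 10| ≤ 1 / 10 ^ 6 := by
    intro i hi
    have h := nmAll_spec nmh2 i hi
    rw [nmchk2, Bool.and_eq_true] at h
    have h1 := nm_row_bound y hy _ (nm_row _ h.1)
    have h2 := nm_row_bound y hy _ (nm_row _ h.2)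
    constructor
    · rw [nmX, add_sub_cancel_left]; exact h1
    · rw [nmY, add_sub_cancel_left]; exact h2
  let Q : ℕ → EuclideanSpace ℝ (Fin 2) := fun i => !₂[nmX y i, nmY y i]
  have hQ0 : ∀ i, Q i 0 = nmX y i := fun i => rfl
  have hQ1 : ∀ i, Q i 1 = nmY y i := fun i => rfl
  have hX : ∀ k, k < 53 → |Q k 0 - (nmcx k : ℝ) / 10 ^ 10| ≤ 1 / 10 ^ 6 := fun k hk => (hrow k hk).1
  have hY : ∀ k, k < 53 → |Q k 1 - (nmcy k : ℝ) / 10 ^ 10| ≤ 1 / 10 ^ 6 := fun k hk => (hrow k hk).2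
  have hdist : ∀ i j, dist (Q i) (Q j) = √((nmX y i - nmX y j) ^ 2 + (nmY y i - nmY y j) ^ 2) := by
    intro i j
    rw [EuclideanSpace.dist_eq, Fin.sum_univ_two, Real.dist_eq, Real.dist_eq, sq_abs, sq_abs]
    simp only [hQ0, hQ1]
  have hinj2 : ∀ i j, i < 53 → j < i → Q i ≠ Q j := by
    intro i j hi hj heq
    have h := nmAll_spec (nmAll_spec nmh4 i hi) j hj
    simp only [Bool.or_eq_true, Nat.blt_eq] at h
    rcases h with h | h
    · have h' : (30000 : ℤ) < |nmcx i - nmcx j| := by rw [Int.abs_eq_natAbs]; exact_mod_cast h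
      have h2 : (30000 : ℝ) < |(nmcx i : ℝ) - nmcx j| := by exact_mod_cast h'
      have a := abs_le.1 (hX i hi)
      have b := abs_le.1 (hX j (hj.trans hi))
      rw [heq] at a
      rcases lt_abs.1 h2 with h2 | h2 <;> linarith [a.1, a.2, b.1, b.2]
    · have h' : (30000 : ℤ) < |nmcy i - nmcy j| := by rw [Int.abs_eq_natAbs]; exact_mod_cast h
      have h2 : (30000 : ℝ) < |(nmcy i : ℝ) - nmcy j| := by exact_mod_cast h'
      have a := abs_le.1 (hY i hi)
      have b := abs_le.1 (hY j (hj.trans hi))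
      rw [heq] at a
      rcases lt_abs.1 h2 with h2 | h2 <;> linarith [a.1, a.2, b.1, b.2]
  have hunit : ∀ e : Fin 106, (e : ℕ) < 103 → dist (Q (nmeu e)) (Q (nmev e)) = 1 := by
    intro e he
    rw [hdist, hsol e he, Real.sqrt_one]
  have hdrop : ∀ e : Fin 106, ¬ (e : ℕ) < 103 → dist (Q (nmeu e)) (Q (nmev e)) ≠ 1 ∧
      |dist (Q (nmeu e)) (Q (nmev e)) - 1| < 0.02 := by
    intro e he
    have hc : nmchk5 e = true := by
      have h5 := nmh5
      have : (e : ℕ) = 103 ∨ (e : ℕ) = 104 ∨ (e : ℕ) = 105 := by omega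
      rcases this with h | h | h <;> rw [h]
      · exact h5.1
      · exact h5.2.1
      · exact h5.2.2
    rw [hdist]
    have a1 := hrow _ (nmeu e).2
    have a2 := hrow _ (nmev e).2
    refine nm_drop e hc _ _ ?_ ?_
    · have b1 := abs_le.1 a1.1
      have b2 := abs_le.1 a2.1
      rw [abs_le, nmdx]
      push_cast
      constructor <;> linarith [b1.1, b1.2, b2.1, b2.2]
    · have b1 := abs_le.1 a1.2
      have b2 := abs_le.1 a2.2
      rw [abs_le, nmdy]
      push_cast
      constructor <;> linarith [b1.1, b1.2, b2.1, b2.2]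
  have hinj : Function.Injective nmedge := fun i j h => nmedge_inj i j h
  refine ⟨fun i => Q i, Finset.univ.map ⟨nmedge, hinj⟩, ?_, ?_, ?_, ?_, ?_, ?_, ?_⟩
  · intro i j hij
    rcases lt_trichotomy (i : ℕ) j with h | h | h
    · exact (hinj2 j i j.2 h hij.symm).elim
    · exact Fin.ext h
    · exact (hinj2 i j i.2 h hij).elim
  · intro e he
    obtain ⟨i, -, rfl⟩ := Finset.mem_map.1 he
    exact nmedge_lt i
  · rw [Finset.card_map, Finset.card_univ, Fintype.card_fin]
  · intro v
    rw [Finset.filter_map, Finset.card_map, ← nmdeg v]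
    congr 1
  · intro e he f hf hne x hx
    obtain ⟨i, -, rfl⟩ := Finset.mem_map.1 he
    obtain ⟨j, -, rfl⟩ := Finset.mem_map.1 hf
    have hij : (i : ℕ) ≠ j := fun h => hne (by rw [Fin.ext h])
    rcases lt_or_gt_of_ne hij with h | h
    · have hp := nmAll_spec (nmAll_spec nmh3 j j.2) i h
      exact (nm_pair Q _ _ _ _ hX hY (nmeu j).2 (nmev j).2 (nmeu i).2 (nmev i).2 hp x hx.2 hx.1).symm
    · have hp := nmAll_spec (nmAll_spec nmh3 i i.2) j h
      exact nm_pair Q _ _ _ _ hX hY (nmeu i).2 (nmev i).2 (nmeu j).2 (nmev j).2 hp x hx.1 hx.2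
  · rw [Finset.filter_map, Finset.card_map, ← nmcard]
    congr 1
    ext i
    simp only [Finset.mem_filter, Finset.mem_univ, true_and, Function.comp]
    constructor
    · intro h
      by_contra hc
      exact (hdrop i hc).1 h
    · intro h
      exact hunit i h
  · intro e he
    obtain ⟨i, -, rfl⟩ := Finset.mem_map.1 he
    by_cases h : (i : ℕ) < 103
    · exact Or.inl (hunit i h)
    · exact Or.inr (hdrop i h).2
end
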